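/- arXiv:2511.00394 — 2 statements merged into one kernel-verified Lean document; each statement's English description precedes it below -/
import Mathlib

section
/- Let q be a prime number with q ≡ 3 (mod 8) or q ≡ 5 (mod 8) and q > 17, and let G = PSL(2, F_q). Then a subgroup H of G fails to be pronormal in G if and only if H has order 2. In particular, every subgroup of G of order different from 2 is pronormal in G. -/
/-- The conjugate `H^g := g⁻¹ H g` of a subgroup `H` by an element `g`. -/
def Subgroup.conjugate {G : Type*} [Group G] (H : Subgroup G) (g : G) : Subgroup G :=
  H.map (MulAut.conj g⁻¹).toMonoidHom

/-- A subgroup `H` of a group `G` is pronormal in `G` if for every `g ∈ G` there exists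
`x ∈ ⟨H, H^g⟩` such that `H^x = H^g`. -/
def IsPronormal {G : Type*} [Group G] (H : Subgroup G) : Prop :=
  ∀ g : G, ∃ x ∈ (H ⊔ H.conjugate g : Subgroup G), H.conjugate x = H.conjugate g


namespace PslPro

section Grp
variable {G : Type*} [Group G]

theorem mem_conjugate {H : Subgroup G} {g y : G} :
    y ∈ H.conjugate g ↔ g * y * g⁻¹ ∈ H := by
  unfold Subgroup.conjugate
  rw [Subgroup.mem_map]
  constructor
  · rintro ⟨x, hx, rfl⟩
    simpa [mul_assoc] using hx
  · intro h
    exact ⟨_, h, by simp [mul_assoc]⟩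

theorem conjugate_mul (H : Subgroup G) (a b : G) :
    H.conjugate (a * b) = (H.conjugate a).conjugate b := by
  ext y
  simp [mem_conjugate, mul_assoc]

theorem conjugate_one (H : Subgroup G) : H.conjugate 1 = H := by
  ext y
  simp [mem_conjugate]

theorem conjugate_mono {H K : Subgroup G} (h : H ≤ K) (g : G) :
    H.conjugate g ≤ K.conjugate g := by
  intro y hy
  rw [mem_conjugate] at *
  exact h hy

theorem conjugate_of_mem {H : Subgroup G} {g : G} (h : g ∈ H) : H.conjugate g = H := by
  ext y
  rw [mem_conjugate]
  constructor
  · intro h'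
    have := H.mul_mem (H.mul_mem (H.inv_mem h) h') h
    simpa [mul_assoc] using this
  · intro h'
    exact H.mul_mem (H.mul_mem h h') (H.inv_mem h)

theorem card_conjugate (H : Subgroup G) (g : G) : Nat.card (H.conjugate g) = Nat.card H := by
  unfold Subgroup.conjugate
  exact (Nat.card_congr (H.equivMapOfInjective _ (MulAut.conj g⁻¹).injective).toEquiv).symm

theorem conjugate_sup (H K : Subgroup G) (g : G) :
    (H ⊔ K).conjugate g = H.conjugate g ⊔ K.conjugate g := by
  unfold Subgroup.conjugate
  exact Subgroup.map_sup _ _ _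

/-- Pronormality is invariant under conjugation. -/
theorem pronormal_of_conjugate {H : Subgroup G} (a : G) (h : IsPronormal (H.conjugate a)) :
    IsPronormal H := by
  intro g
  obtain ⟨x, hx, hxe⟩ := h (a⁻¹ * g * a)
  rw [← conjugate_mul, ← conjugate_mul] at hxe
  refine ⟨a * x * a⁻¹, ?_, ?_⟩
  · rw [← conjugate_mul, show a * (a⁻¹ * g * a) = g * a by group, conjugate_mul,
      ← conjugate_sup, mem_conjugate] at hx
    exact hx
  · rw [conjugate_mul, hxe, ← conjugate_mul]
    congr 1
    group

/-- Reduction to the normalizer of a pronormal subgroup. -/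
theorem pronormal_of_le {P H : Subgroup G} (hPH : P ≤ H) (hP : IsPronormal P)
    (h : ∀ g, P.conjugate g = P → ∃ x ∈ (H ⊔ H.conjugate g : Subgroup G),
      H.conjugate x = H.conjugate g) : IsPronormal H := by
  intro g
  obtain ⟨x, hx, hxe⟩ := hP g
  have hx' : x ∈ H ⊔ H.conjugate g := sup_le_sup hPH (conjugate_mono hPH g) hx
  obtain ⟨y, hy, hye⟩ := h (g * x⁻¹) (by
    rw [conjugate_mul, ← hxe, ← conjugate_mul, mul_inv_cancel, conjugate_one])
  have hle : H ⊔ H.conjugate (g * x⁻¹) ≤ H ⊔ H.conjugate g := by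
    refine sup_le le_sup_left ?_
    rw [conjugate_mul]
    refine (conjugate_mono (le_sup_right : _ ≤ H ⊔ H.conjugate g) _).trans ?_
    rw [conjugate_of_mem (Subgroup.inv_mem _ hx')]
  refine ⟨y * x, Subgroup.mul_mem _ (hle hy) hx', ?_⟩
  rw [conjugate_mul, hye, ← conjugate_mul]
  congr 1
  group

/-- A `p`-subgroup which is the unique subgroup of its order in any `p`-subgroup containing it
is pronormal. -/
theorem pronormal_of_unique [Finite G] {p : ℕ} [Fact p.Prime] {P : Subgroup G}
    (hP : IsPGroup p P)
    (hu : ∀ S P₁ P₂ : Subgroup G, IsPGroup p S → P₁ ≤ S → P₂ ≤ S →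
      Nat.card P₁ = Nat.card P → Nat.card P₂ = Nat.card P → P₁ = P₂) : IsPronormal P := by
  intro g
  set K := P ⊔ P.conjugate g with hK
  have h1 : P ≤ K := le_sup_left
  have h2 : P.conjugate g ≤ K := le_sup_right
  have hPg : IsPGroup p (P.conjugate g) := hP.map _
  obtain ⟨S, hS⟩ := (hP.of_equiv (Subgroup.subgroupOfEquivOfLe h1).symm).exists_le_sylow
  obtain ⟨S', hS'⟩ := (hPg.of_equiv (Subgroup.subgroupOfEquivOfLe h2).symm).exists_le_sylow
  obtain ⟨k, hk⟩ := MulAction.exists_smul_eq K S S'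
  refine ⟨(k : G)⁻¹, K.inv_mem k.2, ?_⟩
  refine hu ((S' : Subgroup K).map K.subtype) _ _ (S'.isPGroup'.map _) ?_ ?_
    (card_conjugate _ _) (card_conjugate _ _)
  · intro y hy
    rw [mem_conjugate, inv_inv] at hy
    have hyK : y ∈ K := by
      have := K.mul_mem (K.mul_mem k.2 (h1 hy)) (K.inv_mem k.2)
      simpa [mul_assoc] using this
    refine ⟨⟨y, hyK⟩, ?_, rfl⟩
    rw [← hk]
    have : (k⁻¹ * ⟨y, hyK⟩ * k : K) ∈ S := hS (by
      rw [Subgroup.mem_subgroupOf]; exact hy)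
    show _ ∈ (k • S : Sylow p K)
    rw [Sylow.smul_def]
    refine (Subgroup.mem_pointwise_smul_iff_inv_smul_mem).2 ?_
    simp only [MulAut.smul_def, ← map_inv, MulAut.conj_apply, inv_inv]
    exact this
  · intro y hy
    exact ⟨⟨y, h2 hy⟩, hS' (by rw [Subgroup.mem_subgroupOf]; exact hy), rfl⟩

end Grp

section Mat
open Matrix

variable {F : Type*} [Field F]

theorem mk_eq_iff {X Y : SpecialLinearGroup (Fin 2) F} :
    ((X : ProjectiveSpecialLinearGroup (Fin 2) F) = Y) ↔ (Y = X ∨ Y = -X) := by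
  rw [QuotientGroup.eq, Matrix.SpecialLinearGroup.mem_center_iff]
  constructor
  · rintro ⟨r, hr, h⟩
    have hr' : r = 1 ∨ r = -1 := by simpa using hr
    have hY : (Y : Matrix (Fin 2) (Fin 2) F) = X * scalar (Fin 2) r := by
      rw [h, ← Matrix.SpecialLinearGroup.coe_mul, mul_inv_cancel_left]
    rcases hr' with rfl | rfl
    · left; ext i j; rw [hY]; simp
    · right; ext i j; rw [hY]; simp
  · rintro (rfl | rfl)
    · exact ⟨1, by simp, by simp⟩
    · refine ⟨-1, by simp, ?_⟩
      ext i j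
      fin_cases i <;> fin_cases j <;> simp

theorem det2 (X : SpecialLinearGroup (Fin 2) F) : X 0 0 * X 1 1 - X 0 1 * X 1 0 = 1 := by
  have := X.2
  rwa [Matrix.det_fin_two] at this

theorem sl_ext {X Y : SpecialLinearGroup (Fin 2) F} (h1 : X 0 0 = Y 0 0) (h2 : X 0 1 = Y 0 1)
    (h3 : X 1 0 = Y 1 0) (h4 : X 1 1 = Y 1 1) : X = Y := by
  ext i j
  fin_cases i <;> fin_cases j <;> assumption

theorem mul00 (X Y : SpecialLinearGroup (Fin 2) F) :
    (X * Y) 0 0 = X 0 0 * Y 0 0 + X 0 1 * Y 1 0 := by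
  simp [Matrix.mul_apply, Fin.sum_univ_two]
theorem mul01 (X Y : SpecialLinearGroup (Fin 2) F) :
    (X * Y) 0 1 = X 0 0 * Y 0 1 + X 0 1 * Y 1 1 := by
  simp [Matrix.mul_apply, Fin.sum_univ_two]
theorem mul10 (X Y : SpecialLinearGroup (Fin 2) F) :
    (X * Y) 1 0 = X 1 0 * Y 0 0 + X 1 1 * Y 1 0 := by
  simp [Matrix.mul_apply, Fin.sum_univ_two]
theorem mul11 (X Y : SpecialLinearGroup (Fin 2) F) :
    (X * Y) 1 1 = X 1 0 * Y 0 1 + X 1 1 * Y 1 1 := by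
  simp [Matrix.mul_apply, Fin.sum_univ_two]

theorem inv00 (X : SpecialLinearGroup (Fin 2) F) : X⁻¹ 0 0 = X 1 1 := by
  simp [Matrix.adjugate_fin_two]
theorem inv01 (X : SpecialLinearGroup (Fin 2) F) : X⁻¹ 0 1 = - X 0 1 := by
  simp [Matrix.adjugate_fin_two]
theorem inv10 (X : SpecialLinearGroup (Fin 2) F) : X⁻¹ 1 0 = - X 1 0 := by
  simp [Matrix.adjugate_fin_two]
theorem inv11 (X : SpecialLinearGroup (Fin 2) F) : X⁻¹ 1 1 = X 0 0 := by
  simp [Matrix.adjugate_fin_two]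

theorem neg_ent (X : SpecialLinearGroup (Fin 2) F) (i j : Fin 2) : (-X) i j = - X i j := by
  simp

theorem one_ent : (1 : SpecialLinearGroup (Fin 2) F) 0 0 = 1 ∧
    (1 : SpecialLinearGroup (Fin 2) F) 0 1 = 0 ∧ (1 : SpecialLinearGroup (Fin 2) F) 1 0 = 0 ∧
    (1 : SpecialLinearGroup (Fin 2) F) 1 1 = 1 := by
  simp

/-- The trace. -/
def tr (X : SpecialLinearGroup (Fin 2) F) : F := X 0 0 + X 1 1

theorem tr_conj (X Y : SpecialLinearGroup (Fin 2) F) : tr (Y * X * Y⁻¹) = tr X := by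
  have := det2 Y
  simp only [tr, mul00, mul11, mul01, mul10, inv00, inv01, inv10, inv11]
  linear_combination (X 0 0 + X 1 1) * this

theorem sq_of_tr_zero {X : SpecialLinearGroup (Fin 2) F} (h : tr X = 0) :
    X * X = -1 := by
  have := det2 X
  unfold tr at h
  obtain ⟨o1, o2, o3, o4⟩ := one_ent (F := F)
  apply sl_ext <;> simp only [mul00, mul11, mul01, mul10, neg_ent, o1, o2, o3, o4] <;> grind

/-- Elements commuting with a non-scalar matrix. -/
theorem comm_form {X Y : SpecialLinearGroup (Fin 2) F}
    (hX : ¬ (X 0 1 = 0 ∧ X 1 0 = 0 ∧ X 0 0 = X 1 1)) (h : X * Y = Y * X) :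
    ∃ a b : F, Y 0 0 = a + b * X 0 0 ∧ Y 0 1 = b * X 0 1 ∧ Y 1 0 = b * X 1 0 ∧
      Y 1 1 = a + b * X 1 1 := by
  have e00 : (X * Y) 0 0 = (Y * X) 0 0 := by rw [h]
  have e01 : (X * Y) 0 1 = (Y * X) 0 1 := by rw [h]
  have e10 : (X * Y) 1 0 = (Y * X) 1 0 := by rw [h]
  simp only [mul00, mul01, mul10] at e00 e01 e10
  by_cases h1 : X 0 1 = 0
  · by_cases h2 : X 1 0 = 0
    · have h3 : X 0 0 - X 1 1 ≠ 0 := fun h' => hX ⟨h1, h2, sub_eq_zero.1 h'⟩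
      refine ⟨Y 0 0 - (Y 0 0 - Y 1 1) / (X 0 0 - X 1 1) * X 0 0,
        (Y 0 0 - Y 1 1) / (X 0 0 - X 1 1), by ring, ?_, ?_, ?_⟩
      · rw [h1] at e01 ⊢
        have : (X 0 0 - X 1 1) * Y 0 1 = 0 := by linear_combination e01
        simpa [h3] using this
      · rw [h2] at e10 ⊢
        have : (X 0 0 - X 1 1) * Y 1 0 = 0 := by linear_combination -e10
        simpa [h3] using this
      · field_simp
        ring
    · refine ⟨Y 0 0 - Y 1 0 / X 1 0 * X 0 0, Y 1 0 / X 1 0, by ring, ?_, ?_, ?_⟩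
      · field_simp
        linear_combination -e00
      · field_simp
      · field_simp
        linear_combination -e10
  · refine ⟨Y 0 0 - Y 0 1 / X 0 1 * X 0 0, Y 0 1 / X 0 1, by ring, ?_, ?_, ?_⟩
    · field_simp
    · field_simp
      linear_combination e00
    · field_simp
      linear_combination e01

theorem mk_one_of_scalar {X : SpecialLinearGroup (Fin 2) F}
    (hX : X 0 1 = 0 ∧ X 1 0 = 0 ∧ X 0 0 = X 1 1) :
    (X : ProjectiveSpecialLinearGroup (Fin 2) F) = 1 := by
  obtain ⟨h1, h2, h3⟩ := hX
  have hd := det2 X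
  obtain ⟨o1, o2, o3, o4⟩ := one_ent (F := F)
  symm
  rw [← QuotientGroup.mk_one, mk_eq_iff]
  have : (X 0 0 - 1) * (X 0 0 + 1) = 0 := by rw [h1, ← h3] at hd; linear_combination hd
  rcases mul_eq_zero.1 this with h | h
  · left; apply sl_ext <;> grind
  · right; apply sl_ext <;> simp only [neg_ent] <;> grind

theorem mk_sq_of_tr_zero {X : SpecialLinearGroup (Fin 2) F} (h : tr X = 0) :
    (X : ProjectiveSpecialLinearGroup (Fin 2) F) ^ 2 = 1 := by
  rw [pow_two, ← QuotientGroup.mk_mul, sq_of_tr_zero h]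
  symm
  rw [← QuotientGroup.mk_one, mk_eq_iff]
  right; rfl

/-- Involutions lift to trace zero. -/
theorem tr_zero_of_sq {X : SpecialLinearGroup (Fin 2) F}
    (h : (X : ProjectiveSpecialLinearGroup (Fin 2) F) ^ 2 = 1)
    (h1 : (X : ProjectiveSpecialLinearGroup (Fin 2) F) ≠ 1) : tr X = 0 := by
  by_contra ht
  apply h1
  apply mk_one_of_scalar
  rw [pow_two, ← QuotientGroup.mk_mul] at h
  have h := h.symm
  rw [← QuotientGroup.mk_one, mk_eq_iff] at h
  obtain ⟨o1, o2, o3, o4⟩ := one_ent (F := F)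
  have key : (X * X) 0 1 = 0 ∧ (X * X) 1 0 = 0 ∧ (X * X) 0 0 = (X * X) 1 1 := by
    rcases h with h | h <;> rw [h] <;> simp
  simp only [mul00, mul01, mul10, mul11] at key
  unfold tr at ht
  obtain ⟨k1, k2, k3⟩ := key
  refine ⟨?_, ?_, ?_⟩
  · exact (mul_eq_zero.1 (by linear_combination k1 : (X 0 0 + X 1 1) * X 0 1 = 0)).resolve_left ht
  · exact (mul_eq_zero.1 (by linear_combination k2 : (X 0 0 + X 1 1) * X 1 0 = 0)).resolve_left ht
  · have := (mul_eq_zero.1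
      (by linear_combination k3 : (X 0 0 + X 1 1) * (X 0 0 - X 1 1) = 0)).resolve_left ht
    exact sub_eq_zero.1 this

/-- A1. -/
theorem a1 (h2 : ¬ IsSquare (2 : F)) (x : ProjectiveSpecialLinearGroup (Fin 2) F)
    (hx : x ^ 4 = 1) : x ^ 2 = 1 := by
  obtain ⟨X, rfl⟩ := QuotientGroup.mk_surjective x
  by_contra hne
  have := tr_zero_of_sq (X := X * X) (by
    rw [QuotientGroup.mk_mul, ← pow_two, ← pow_mul]; exact hx) (by
    rw [QuotientGroup.mk_mul, ← pow_two]; exact hne)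
  have hd := det2 X
  apply h2
  refine ⟨tr X, ?_⟩
  simp only [tr, mul00, mul11] at *
  linear_combination -this - 2 * hd

/-- lifts of commuting elements -/
theorem comm_lift {X Y : SpecialLinearGroup (Fin 2) F}
    (h : (X : ProjectiveSpecialLinearGroup (Fin 2) F) * Y = Y * X) :
    X * Y = Y * X ∨ X * Y = - (Y * X) := by
  rw [← QuotientGroup.mk_mul, ← QuotientGroup.mk_mul, eq_comm, mk_eq_iff] at h
  exact h

theorem comm_lift' {X Y : SpecialLinearGroup (Fin 2) F} (h2 : (2 : F) ≠ 0)
    (hX : (X : ProjectiveSpecialLinearGroup (Fin 2) F) ^ 2 ≠ 1)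
    (h : (X : ProjectiveSpecialLinearGroup (Fin 2) F) * Y = Y * X) :
    X * Y = Y * X := by
  rcases comm_lift h with h | h
  · exact h
  · exfalso
    apply hX
    apply mk_sq_of_tr_zero
    have h' : Y * X * Y⁻¹ = -X := by
      rw [← neg_eq_iff_eq_neg] at h
      rw [← h]; simp
    have := tr_conj X Y
    rw [h'] at this
    unfold tr at *
    simp only [neg_ent] at this
    have h3 : 2 * (X 0 0 + X 1 1) = 0 := by linear_combination -this
    exact (mul_eq_zero.1 h3).resolve_left h2

theorem nonscalar {X : SpecialLinearGroup (Fin 2) F}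
    (hX : (X : ProjectiveSpecialLinearGroup (Fin 2) F) ^ 2 ≠ 1) :
    ¬ (X 0 1 = 0 ∧ X 1 0 = 0 ∧ X 0 0 = X 1 1) := by
  intro h
  apply hX
  rw [mk_one_of_scalar h]; simp

/-- A3. -/
theorem a3 (h2 : (2 : F) ≠ 0) (X Y : SpecialLinearGroup (Fin 2) F)
    (hX : (X : ProjectiveSpecialLinearGroup (Fin 2) F) ^ 2 ≠ 1) (ht : tr X ^ 2 ≠ 4)
    (hc : X * (Y * X * Y⁻¹) = (Y * X * Y⁻¹) * X) :
    (Y * X = X * Y) ∨ ∀ T, X * T = T * X → Y * T * Y⁻¹ = T⁻¹ := by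
  set Z := Y * X * Y⁻¹ with hZ
  have hXd := det2 X
  have hZd := det2 Z
  have hZt : tr Z = tr X := tr_conj X Y
  have hZY : Z * Y = Y * X := by rw [hZ]; simp
  obtain ⟨a, b, e1, e2, e3, e4⟩ := comm_form (nonscalar hX) hc
  unfold tr at *
  have hb : (1 - b) * (1 + b) = 0 := by
    have : ((X 0 0 + X 1 1) ^ 2 - 4) * ((1 - b) * (1 + b)) = 0 := by
      grind
    exact (mul_eq_zero.1 this).resolve_left (sub_ne_zero.2 ht)
  rcases mul_eq_zero.1 hb with hb | hb
  · left
    rw [← hZY]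
    congr 1
    have hb : b = 1 := by linear_combination -hb
    subst hb
    have ha : a = 0 := by
      have : 2 * a = 0 := by linear_combination hZt - e1 - e4
      exact (mul_eq_zero.1 this).resolve_left h2
    subst ha
    apply sl_ext <;> grind
  · right
    have hb : b = -1 := by linear_combination hb
    subst hb
    have ha : a = X 0 0 + X 1 1 := by
      have : 2 * (a - (X 0 0 + X 1 1)) = 0 := by linear_combination hZt - e1 - e4
      exact sub_eq_zero.1 ((mul_eq_zero.1 this).resolve_left h2)
    subst ha
    intro T hT
    obtain ⟨a, b, f1, f2, f3, f4⟩ := comm_form (nonscalar hX) hT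
    rw [mul_inv_eq_iff_eq_mul]
    have g00 : (Z * Y) 0 0 = (Y * X) 0 0 := by rw [hZY]
    have g01 : (Z * Y) 0 1 = (Y * X) 0 1 := by rw [hZY]
    have g10 : (Z * Y) 1 0 = (Y * X) 1 0 := by rw [hZY]
    have g11 : (Z * Y) 1 1 = (Y * X) 1 1 := by rw [hZY]
    simp only [mul00, mul11, mul01, mul10, e1, e2, e3, e4] at g00 g01 g10 g11
    apply sl_ext <;> simp only [mul00, mul11, mul01, mul10, inv00, inv01, inv10, inv11, f1, f2, f3, f4]
    · linear_combination -b * g00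
    · linear_combination -b * g01
    · linear_combination -b * g10
    · linear_combination -b * g11

theorem coeff_uniq {X : SpecialLinearGroup (Fin 2) F}
    (hX : ¬ (X 0 1 = 0 ∧ X 1 0 = 0 ∧ X 0 0 = X 1 1)) {a b a' b' : F}
    (h1 : a + b * X 0 0 = a' + b' * X 0 0) (h2 : b * X 0 1 = b' * X 0 1)
    (h3 : b * X 1 0 = b' * X 1 0) (h4 : a + b * X 1 1 = a' + b' * X 1 1) : a = a' ∧ b = b' := by
  have hb : b = b' := by
    by_contra hne
    have hne : b - b' ≠ 0 := sub_ne_zero.2 hne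
    apply hX
    refine ⟨?_, ?_, ?_⟩
    · exact (mul_eq_zero.1 (by linear_combination h2 : (b - b') * X 0 1 = 0)).resolve_left hne
    · exact (mul_eq_zero.1 (by linear_combination h3 : (b - b') * X 1 0 = 0)).resolve_left hne
    · exact sub_eq_zero.1 ((mul_eq_zero.1
        (by linear_combination h1 - h4 : (b - b') * (X 0 0 - X 1 1) = 0)).resolve_left hne)
  subst hb
  exact ⟨by linear_combination h1, rfl⟩

theorem cent_cyclic_aux [Finite F] (h2 : (2 : F) ≠ 0) {X : SpecialLinearGroup (Fin 2) F}
    (hX : ¬ (X 0 1 = 0 ∧ X 1 0 = 0 ∧ X 0 0 = X 1 1)) (ht : tr X ^ 2 ≠ 4)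
    {K : Type*} [Field K] (φ : F →+* K) (l : K) (hl2 : l ^ 2 = φ (tr X) * l - 1) :
    IsCyclic (Subgroup.centralizer {X}) := by
  have hco : ∀ Y : Subgroup.centralizer {X}, ∃ a b : F, Y.1 0 0 = a + b * X 0 0 ∧
      Y.1 0 1 = b * X 0 1 ∧ Y.1 1 0 = b * X 1 0 ∧ Y.1 1 1 = a + b * X 1 1 := fun Y =>
    comm_form hX (Subgroup.mem_centralizer_iff.1 Y.2 X rfl)
  choose a b e1 e2 e3 e4 using hco
  have hXd := det2 X
  obtain ⟨o1, o2, o3, o4⟩ := one_ent (F := F)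
  have hone : a 1 = 1 ∧ b 1 = 0 := by
    apply coeff_uniq hX
    · rw [← e1]; simp
    · rw [← e2]; simp
    · rw [← e3]; simp
    · rw [← e4]; simp
  have hmul : ∀ Y Z, a (Y * Z) = a Y * a Z - b Y * b Z ∧
      b (Y * Z) = a Y * b Z + b Y * a Z + tr X * b Y * b Z := by
    intro Y Z
    apply coeff_uniq hX
    · rw [← e1, Subgroup.coe_mul, mul00, e1, e1, e2, e3, tr]
      linear_combination -(b Y * b Z) * hXd
    · rw [← e2, Subgroup.coe_mul, mul01, e1, e2, e2, e4, tr]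
      ring
    · rw [← e3, Subgroup.coe_mul, mul10, e3, e1, e3, e4, tr]
      ring
    · rw [← e4, Subgroup.coe_mul, mul11, e3, e2, e4, e4, tr]
      linear_combination -(b Y * b Z) * hXd
  let f : Subgroup.centralizer {X} →* K :=
    { toFun := fun Y => φ (a Y) + φ (b Y) * l
      map_one' := by rw [hone.1, hone.2]; simp
      map_mul' := by
        intro Y Z
        rw [(hmul Y Z).1, (hmul Y Z).2]
        simp only [map_add, map_sub, map_mul]
        linear_combination -(φ (b Y) * φ (b Z)) * hl2 }
  have hker : ∀ Y, f Y = 1 → Y = 1 := by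
    intro Y hY
    have hY : φ (a Y) + φ (b Y) * l = 1 := hY
    have hd : a Y ^ 2 + a Y * b Y * tr X + b Y ^ 2 = 1 := by
      have := det2 Y.1
      rw [e1, e2, e3, e4] at this
      rw [tr]
      linear_combination this - (b Y)^2 * hXd
    have hdK : φ (a Y) ^ 2 + φ (a Y) * φ (b Y) * φ (tr X) + φ (b Y) ^ 2 = 1 := by
      rw [← map_one φ, ← hd]; simp
    have htr : 2 * φ (a Y) + φ (tr X) * φ (b Y) = 2 := by
      have : φ (b Y) * l = 1 - φ (a Y) := by linear_combination hY
      have h5 : (φ (b Y) * l) ^ 2 = φ (tr X) * φ (b Y) * (φ (b Y) * l) - φ (b Y) ^ 2 := by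
        linear_combination (φ (b Y))^2 * hl2
      rw [this] at h5
      linear_combination hdK - h5
    have htr' : 2 * a Y + tr X * b Y = 2 := by
      apply φ.injective
      simpa [map_ofNat φ 2] using htr
    have hb : b Y = 0 := by
      have : (b Y) ^ 2 * (tr X ^ 2 - 4) = 0 := by
        linear_combination -4 * hd + (2 * a Y + tr X * b Y + 2) * htr'
      have := (mul_eq_zero.1 this).resolve_right (sub_ne_zero.2 ht)
      simpa using this
    have ha : a Y = 1 := by
      rw [hb] at htr'
      have : 2 * (a Y - 1) = 0 := by linear_combination htr'
      exact sub_eq_zero.1 ((mul_eq_zero.1 this).resolve_left h2)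
    apply Subtype.ext
    apply sl_ext
    · rw [e1, ha, hb]; simp
    · rw [e2, hb]; simp
    · rw [e3, hb]; simp
    · rw [e4, ha, hb]; simp
  refine isCyclic_of_injective_ringHom f ?_
  intro Y Z h
  have h1 : f (Z⁻¹ * Y) = f (Z⁻¹ * Z) := by rw [map_mul, h, map_mul]
  rw [inv_mul_cancel, map_one] at h1
  exact (inv_mul_eq_one.1 (hker _ h1)).symm

theorem cent_cyclic [Finite F] (h2 : (2 : F) ≠ 0) {X : SpecialLinearGroup (Fin 2) F}
    (hX : ¬ (X 0 1 = 0 ∧ X 1 0 = 0 ∧ X 0 0 = X 1 1)) (ht : tr X ^ 2 ≠ 4) :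
    IsCyclic (Subgroup.centralizer {X}) := by
  obtain ⟨z, hz⟩ := IsAlgClosed.exists_pow_nat_eq
    (algebraMap F (AlgebraicClosure F) (tr X ^ 2 - 4)) (n := 2) (by simp)
  have h2K : (2 : AlgebraicClosure F) ≠ 0 := by
    rw [← map_ofNat (algebraMap F (AlgebraicClosure F)) 2]
    exact (map_ne_zero _).2 h2
  refine cent_cyclic_aux h2 hX ht (algebraMap F (AlgebraicClosure F))
    ((algebraMap F (AlgebraicClosure F) (tr X) + z) / 2) ?_
  rw [map_sub, map_pow, map_ofNat (algebraMap F (AlgebraicClosure F)) 4] at hz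
  generalize algebraMap F (AlgebraicClosure F) (tr X) = t at *
  field_simp
  linear_combination hz

/-- A2. -/
theorem a2 [Finite F] (h2 : (2 : F) ≠ 0) {X : SpecialLinearGroup (Fin 2) F}
    (hX : (X : ProjectiveSpecialLinearGroup (Fin 2) F) ^ 2 ≠ 1) (ht : tr X ^ 2 ≠ 4) :
    IsCyclic (Subgroup.centralizer {(X : ProjectiveSpecialLinearGroup (Fin 2) F)}) := by
  have := cent_cyclic h2 (nonscalar hX) ht
  let f : Subgroup.centralizer {X} →*
      Subgroup.centralizer {(X : ProjectiveSpecialLinearGroup (Fin 2) F)} :=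
    ((QuotientGroup.mk' _).comp (Subgroup.centralizer {X}).subtype).codRestrict _ (by
      intro Y
      rw [Subgroup.mem_centralizer_iff]
      rintro _ rfl
      have := Subgroup.mem_centralizer_iff.1 Y.2 X rfl
      simp only [MonoidHom.comp_apply, Subgroup.subtype_apply, QuotientGroup.mk'_apply]
      rw [← QuotientGroup.mk_mul, ← QuotientGroup.mk_mul, this])
  refine isCyclic_of_surjective f ?_
  rintro ⟨y, hy⟩
  obtain ⟨Y, rfl⟩ := QuotientGroup.mk_surjective y
  have := Subgroup.mem_centralizer_iff.1 hy _ rfl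
  refine ⟨⟨Y, ?_⟩, ?_⟩
  · rw [Subgroup.mem_centralizer_iff]
    rintro _ rfl
    exact comm_lift' h2 hX this
  · rfl

theorem anticomm {Z W : SpecialLinearGroup (Fin 2) F} (h2 : (2 : F) ≠ 0)
    (hz : tr Z = 0) (hw : tr W = 0)
    (hz1 : (Z : ProjectiveSpecialLinearGroup (Fin 2) F) ≠ 1)
    (hzw : (Z : ProjectiveSpecialLinearGroup (Fin 2) F) ≠ W)
    (hc : (Z : ProjectiveSpecialLinearGroup (Fin 2) F) * W = W * Z) : Z * W = -(W * Z) := by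
  refine (comm_lift hc).resolve_left ?_
  intro h
  obtain ⟨a, b, e1, e2, e3, e4⟩ := comm_form (fun h' => hz1 (mk_one_of_scalar h')) h
  unfold tr at *
  have ha : a = 0 := by
    have : 2 * a = 0 := by grind
    exact (mul_eq_zero.1 this).resolve_left h2
  subst ha
  have hd := det2 Z
  have hd' := det2 W
  have hb : (b - 1) * (b + 1) = 0 := by grind
  apply hzw
  rw [mk_eq_iff]
  rcases mul_eq_zero.1 hb with hb | hb
  · left; apply sl_ext <;> grind
  · right; apply sl_ext <;> simp only [neg_ent] <;> grind

theorem cent_anticomm {Z W Y : SpecialLinearGroup (Fin 2) F} (h2 : (2 : F) ≠ 0)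
    (hz1 : (Z : ProjectiveSpecialLinearGroup (Fin 2) F) ≠ 1)
    (hc : Z * W = -(W * Z)) (h1 : Z * Y = Y * Z) (h3 : W * Y = Y * W) :
    (Y : ProjectiveSpecialLinearGroup (Fin 2) F) = 1 := by
  have hW : Y * W * Y⁻¹ = W := by rw [← h3]; simp
  have hns := (fun h' => hz1 (mk_one_of_scalar h'))
  obtain ⟨a, b, e1, e2, e3, e4⟩ := comm_form hns h1
  have c00 : (Z * W) 0 0 = (-(W * Z)) 0 0 := by rw [hc]
  have c01 : (Z * W) 0 1 = (-(W * Z)) 0 1 := by rw [hc]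
  have c10 : (Z * W) 1 0 = (-(W * Z)) 1 0 := by rw [hc]
  have c11 : (Z * W) 1 1 = (-(W * Z)) 1 1 := by rw [hc]
  have d00 : (W * Y) 0 0 = (Y * W) 0 0 := by rw [h3]
  have d01 : (W * Y) 0 1 = (Y * W) 0 1 := by rw [h3]
  have d10 : (W * Y) 1 0 = (Y * W) 1 0 := by rw [h3]
  have d11 : (W * Y) 1 1 = (Y * W) 1 1 := by rw [h3]
  have hdet := det2 (W * Z)
  simp only [neg_ent, mul00, mul01, mul10, mul11, e1, e2, e3, e4] at c00 c01 c10 c11 d00 d01 d10 d11 hdet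
  have hb : b = 0 := by
    by_contra hb
    have k : ∀ t : F, 2 * (b * t) = 0 → t = 0 := by
      intro t ht
      simpa [h2, hb] using ht
    have k1 := k (W 0 0 * Z 0 0 + W 0 1 * Z 1 0) (by linear_combination d00 + b * c00)
    have k2 := k (W 0 0 * Z 0 1 + W 0 1 * Z 1 1) (by linear_combination d01 + b * c01)
    rw [k1, k2] at hdet
    simp at hdet
  apply mk_one_of_scalar
  rw [e1, e2, e3, e4, hb]
  simp

/-- A4. -/
theorem a4 (h2 : (2 : F) ≠ 0) (z w y : ProjectiveSpecialLinearGroup (Fin 2) F)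
    (hz : z ^ 2 = 1) (hw : w ^ 2 = 1) (hz1 : z ≠ 1) (hw1 : w ≠ 1) (hzw : z ≠ w)
    (hc : z * w = w * z) (h1 : z * y = y * z) (h3 : w * y = y * w) :
    y = 1 ∨ y = z ∨ y = w ∨ y = z * w := by
  obtain ⟨Z, rfl⟩ := QuotientGroup.mk_surjective z
  obtain ⟨W, rfl⟩ := QuotientGroup.mk_surjective w
  obtain ⟨Y, rfl⟩ := QuotientGroup.mk_surjective y
  have hZW := anticomm h2 (tr_zero_of_sq hz hz1) (tr_zero_of_sq hw hw1) hz1 hzw hc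
  have hWZ : W * Z = -(Z * W) := by rw [hZW, neg_neg]
  have hz' := inv_eq_of_mul_eq_one_right ((pow_two _).symm.trans hz)
  have hw' := inv_eq_of_mul_eq_one_right ((pow_two _).symm.trans hw)
  have key := fun Y => cent_anticomm (Y := Y) h2 hz1 hZW
  rcases comm_lift h1 with h1 | h1 <;> rcases comm_lift h3 with h3 | h3
  · left; exact key Y h1 h3
  · right; left
    have := key (Y * Z) (by rw [← mul_assoc, h1]) (by
      rw [← mul_assoc, h3, neg_mul, mul_assoc, hWZ, mul_neg, neg_neg, mul_assoc])
    rw [QuotientGroup.mk_mul] at this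
    rw [mul_eq_one_iff_eq_inv.1 this, hz']
  · right; right; left
    have := key (Y * W) (by
      rw [← mul_assoc, h1, neg_mul, mul_assoc, hZW, mul_neg, neg_neg, mul_assoc])
      (by rw [← mul_assoc, h3])
    rw [QuotientGroup.mk_mul] at this
    rw [mul_eq_one_iff_eq_inv.1 this, hw']
  · right; right; right
    have := key (Y * (W * Z)) (by
      rw [← mul_assoc, h1, neg_mul, mul_assoc, ← mul_assoc Z W Z, hZW, neg_mul, mul_neg, neg_neg]
      simp only [mul_assoc]) (by
      rw [← mul_assoc, h3, neg_mul, mul_assoc, mul_assoc Y (W * Z) W, mul_assoc W Z W, hZW]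
      simp only [mul_neg])
    rw [QuotientGroup.mk_mul, QuotientGroup.mk_mul] at this
    rw [mul_eq_one_iff_eq_inv.1 this, _root_.mul_inv_rev, hz', hw']

theorem exists_sl (a b c d : F) (h : a * d - b * c = 1) : ∃ W : SpecialLinearGroup (Fin 2) F,
    W 0 0 = a ∧ W 0 1 = b ∧ W 1 0 = c ∧ W 1 1 = d :=
  ⟨⟨!![a, b; c, d], by simpa [Matrix.det_fin_two] using h⟩, by simp⟩

/-- Existence of an anticommuting element. -/
theorem exists_anticomm {u v : F} (huv : u ^ 2 + v ^ 2 = -1) {Z : SpecialLinearGroup (Fin 2) F}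
    (hz : tr Z = 0) : ∃ W : SpecialLinearGroup (Fin 2) F, tr W = 0 ∧ Z * W = -(W * Z) := by
  have hd := det2 Z
  unfold tr at hz
  have e : Z 1 1 = - Z 0 0 := by linear_combination hz
  rw [e] at hd
  suffices h : ∃ x y t : F, -x ^ 2 - y * t = 1 ∧ 2 * Z 0 0 * x + Z 0 1 * t + Z 1 0 * y = 0 by
    obtain ⟨x, y, t, h1, h2⟩ := h
    obtain ⟨W, w1, w2, w3, w4⟩ := exists_sl x y t (-x) (by linear_combination h1)
    refine ⟨W, by simp [tr, w1, w4], ?_⟩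
    apply sl_ext <;> simp only [neg_ent, mul00, mul01, mul10, mul11, e, w1, w2, w3, w4]
    · linear_combination h2
    · ring
    · ring
    · linear_combination h2
  by_cases hc : Z 1 0 = 0
  · by_cases hb : Z 0 1 = 0
    · exact ⟨0, 1, -1, by ring, by rw [hb, hc]; ring⟩
    · refine ⟨u + Z 0 0 * v, Z 0 1 * v, (-2 * Z 0 0 * u - Z 0 0 ^ 2 * v + v) / Z 0 1, ?_, ?_⟩
      · field_simp
        linear_combination -huv
      · field_simp
        linear_combination (-v) * hd
  · refine ⟨u + Z 0 0 * v, (-2 * Z 0 0 * u - Z 0 0 ^ 2 * v + v) / Z 1 0, Z 1 0 * v, ?_, ?_⟩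
    · field_simp
      linear_combination -huv
    · field_simp
      linear_combination (-v) * hd

/-- A5. -/
theorem a5 (h2 : (2 : F) ≠ 0) {u v : F} (huv : u ^ 2 + v ^ 2 = -1)
    (z : ProjectiveSpecialLinearGroup (Fin 2) F) (hz : z ^ 2 = 1) (hz1 : z ≠ 1) :
    ∃ g, g * z * g⁻¹ ≠ z ∧ z * (g * z * g⁻¹) = (g * z * g⁻¹) * z := by
  obtain ⟨Z, rfl⟩ := QuotientGroup.mk_surjective z
  have ht := tr_zero_of_sq hz hz1
  obtain ⟨W, hw, hZW⟩ := exists_anticomm huv ht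
  have hZ2 := sq_of_tr_zero ht
  have hW2 := sq_of_tr_zero hw
  have ez : Z 1 1 = - Z 0 0 := by unfold tr at ht; linear_combination ht
  have ew : W 1 1 = - W 0 0 := by unfold tr at hw; linear_combination hw
  have dz := det2 Z
  have dw := det2 W
  have c00 : (Z * W) 0 0 = (-(W * Z)) 0 0 := by rw [hZW]
  have c01 : (Z * W) 0 1 = (-(W * Z)) 0 1 := by rw [hZW]
  have c10 : (Z * W) 1 0 = (-(W * Z)) 1 0 := by rw [hZW]
  have c11 : (Z * W) 1 1 = (-(W * Z)) 1 1 := by rw [hZW]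
  simp only [neg_ent, mul00, mul01, mul10, mul11, ez, ew] at c00 c01 c10 c11 dz dw
  obtain ⟨g, g1, g2, g3, g4⟩ := exists_sl
    ((1 + Z 0 0 + W 0 0 + (Z 0 0 * W 0 0 + Z 0 1 * W 1 0)) / 2)
    ((Z 0 1 + W 0 1 + (Z 0 0 * W 0 1 - Z 0 1 * W 0 0)) / 2)
    ((Z 1 0 + W 1 0 + (Z 1 0 * W 0 0 - Z 0 0 * W 1 0)) / 2)
    ((1 - Z 0 0 - W 0 0 + (Z 1 0 * W 0 1 + Z 0 0 * W 0 0)) / 2) (by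
      field_simp
      grind)
  have hg : g * Z = W * g := by
    apply sl_ext <;> simp only [mul00, mul01, mul10, mul11, ez, ew, g1, g2, g3, g4] <;> field_simp
    · grind
    · grind
    · grind
    · grind
  have hgz : ((g : ProjectiveSpecialLinearGroup (Fin 2) F) * Z *
      (g : ProjectiveSpecialLinearGroup (Fin 2) F)⁻¹) = W := by
    rw [← QuotientGroup.mk_mul, hg, QuotientGroup.mk_mul, mul_inv_cancel_right]
  refine ⟨g, ?_, ?_⟩
  · rw [hgz]
    intro h
    rw [eq_comm, mk_eq_iff] at h
    have h3 : Z * W = W * Z := by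
      rcases h with rfl | rfl
      · rfl
      · simp
    have h4 : W * Z = -(W * Z) := h3.symm.trans hZW
    have h5 : ∀ i j, (W * Z) i j = 0 := by
      intro i j
      have : (W * Z) i j = (-(W * Z)) i j := by rw [← h4]
      rw [neg_ent] at this
      have : 2 * (W * Z) i j = 0 := by linear_combination this
      exact (mul_eq_zero.1 this).resolve_left h2
    have := det2 (W * Z)
    simp only [h5] at this
    simp at this
  · rw [hgz, ← QuotientGroup.mk_mul, ← QuotientGroup.mk_mul, eq_comm, mk_eq_iff]
    right; exact hZW

/-- If the trace is `±2` then the class has order dividing `q`. -/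
theorem pow_of_tr (q : ℕ) [Fact q.Prime] [CharP F q]
    {X : SpecialLinearGroup (Fin 2) F} (ht : tr X ^ 2 = 4) :
    (X : ProjectiveSpecialLinearGroup (Fin 2) F) ^ q = 1 := by
  have key : ∀ Y : SpecialLinearGroup (Fin 2) F, tr Y = 2 → Y ^ q = 1 := by
    intro Y hY
    have hd := det2 Y
    unfold tr at hY
    have h0 : (Y.1 - 1) ^ 2 = 0 := by
      rw [pow_two]
      ext i j
      fin_cases i <;> fin_cases j <;> simp [Matrix.mul_apply, Fin.sum_univ_two]
      · linear_combination (Y 0 0) * hY - hd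
      · linear_combination (Y 0 1) * hY
      · linear_combination (Y 1 0) * hY
      · linear_combination (Y 1 1) * hY - hd
    have h1 : (Y.1 - 1) ^ q = 0 := pow_eq_zero_of_le (Nat.Prime.two_le Fact.out) h0
    rw [sub_pow_char_of_commute q (Commute.one_right Y.1), one_pow, sub_eq_zero] at h1
    apply Subtype.ext
    rw [Matrix.SpecialLinearGroup.coe_pow, h1, Matrix.SpecialLinearGroup.coe_one]
  have h4 : (tr X - 2) * (tr X + 2) = 0 := by linear_combination ht
  rcases mul_eq_zero.1 h4 with h | h
  · rw [← QuotientGroup.mk_pow, key X (by linear_combination h), QuotientGroup.mk_one]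
  · have : (X : ProjectiveSpecialLinearGroup (Fin 2) F) =
      ((-X : SpecialLinearGroup (Fin 2) F) : ProjectiveSpecialLinearGroup (Fin 2) F) :=
      mk_eq_iff.2 (Or.inr rfl)
    rw [this, ← QuotientGroup.mk_pow, key (-X) ?_, QuotientGroup.mk_one]
    unfold tr at *
    rw [neg_ent, neg_ent]
    linear_combination -h

theorem unip_lift (q : ℕ) [Fact q.Prime] [CharP F q] (hq2 : q ≠ 2)
    (u : ProjectiveSpecialLinearGroup (Fin 2) F) (hu : u ^ q = 1) :
    ∃ U : SpecialLinearGroup (Fin 2) F,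
      (U : ProjectiveSpecialLinearGroup (Fin 2) F) = u ∧ tr U = 2 := by
  have hodd : Odd q := (Fact.out : q.Prime).odd_of_ne_two hq2
  have key : ∀ Y : SpecialLinearGroup (Fin 2) F, Y ^ q = 1 → tr Y = 2 := by
    intro Y hY
    have h1 : (Y.1 - 1) ^ q = 0 := by
      rw [sub_pow_char_of_commute q (Commute.one_right Y.1), one_pow,
        ← Matrix.SpecialLinearGroup.coe_pow, hY, Matrix.SpecialLinearGroup.coe_one, sub_self]
    have h2 : (Y.1 - 1).det = 0 := by
      have := congrArg Matrix.det h1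
      rw [Matrix.det_pow, Matrix.det_zero] at this
      exact pow_eq_zero_iff (Nat.Prime.ne_zero Fact.out) |>.1 this
    rw [Matrix.det_fin_two] at h2
    simp at h2
    have hd := det2 Y
    unfold tr
    linear_combination hd - h2
  obtain ⟨U, rfl⟩ := QuotientGroup.mk_surjective u
  rw [← QuotientGroup.mk_pow, ← QuotientGroup.mk_one, eq_comm, mk_eq_iff] at hu
  rcases hu with h | h
  · exact ⟨U, rfl, key U h⟩
  · refine ⟨-U, mk_eq_iff.2 (Or.inr (by simp)), key _ ?_⟩
    rw [hodd.neg_pow, h, neg_neg]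

/-- Upper unitriangular matrices. -/
def eU (s : F) : SpecialLinearGroup (Fin 2) F :=
  ⟨!![1, s; 0, 1], by simp [Matrix.det_fin_two]⟩
/-- Lower unitriangular matrices. -/
def fL (s : F) : SpecialLinearGroup (Fin 2) F :=
  ⟨!![1, 0; s, 1], by simp [Matrix.det_fin_two]⟩

theorem eU_ent (s : F) : eU s 0 0 = 1 ∧ eU s 0 1 = s ∧ eU s 1 0 = 0 ∧ eU s 1 1 = 1 := by
  simp [eU]
theorem fL_ent (s : F) : fL s 0 0 = 1 ∧ fL s 0 1 = 0 ∧ fL s 1 0 = s ∧ fL s 1 1 = 1 := by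
  simp [fL]

theorem eU_add (s t : F) : eU (s + t) = eU s * eU t := by
  obtain ⟨a1, a2, a3, a4⟩ := eU_ent s
  obtain ⟨b1, b2, b3, b4⟩ := eU_ent t
  obtain ⟨c1, c2, c3, c4⟩ := eU_ent (s + t)
  apply sl_ext <;> simp only [mul00, mul01, mul10, mul11, a1, a2, a3, a4, b1, b2, b3, b4,
    c1, c2, c3, c4] <;> ring

theorem eU_zero : eU (0 : F) = 1 := by
  have := eU_add (0 : F) 0
  rw [add_zero] at this
  simpa using this

theorem eU_pow (s : F) (n : ℕ) : eU s ^ n = eU (n * s) := by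
  induction n with
  | zero => simp [eU_zero]
  | succ k ih =>
    rw [pow_succ, ih, ← eU_add]
    congr 1
    push_cast
    ring

theorem gen_top (K : Subgroup (SpecialLinearGroup (Fin 2) F)) (he : ∀ s, eU s ∈ K)
    (Y : SpecialLinearGroup (Fin 2) F) (hY : Y 1 0 ≠ 0) (hY' : ∀ s, Y⁻¹ * eU s * Y ∈ K) :
    K = ⊤ := by
  have hf : ∀ s, fL s ∈ K := by
    intro s
    have : fL s = eU (Y 1 1 / Y 1 0) * (Y⁻¹ * eU (- s / (Y 1 0) ^ 2) * Y) *
        eU (- Y 1 1 / Y 1 0) := by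
      have hd := det2 Y
      have hb : Y 0 1 = (Y 0 0 * Y 1 1 - 1) / Y 1 0 := by
        rw [eq_div_iff hY]; linear_combination -hd
      obtain ⟨a1, a2, a3, a4⟩ := eU_ent (Y 1 1 / Y 1 0)
      obtain ⟨b1, b2, b3, b4⟩ := eU_ent (- Y 1 1 / Y 1 0)
      obtain ⟨c1, c2, c3, c4⟩ := eU_ent (- s / (Y 1 0) ^ 2)
      obtain ⟨d1, d2, d3, d4⟩ := fL_ent s
      apply sl_ext <;> simp only [mul00, mul01, mul10, mul11, a1, a2, a3, a4, b1, b2, b3, b4,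
        c1, c2, c3, c4, d1, d2, d3, d4, inv00, inv01, inv10, inv11, hb] <;> field_simp <;> ring
    rw [this]
    exact K.mul_mem (K.mul_mem (he _) (hY' _)) (he _)
  have hc : ∀ X : SpecialLinearGroup (Fin 2) F, X 1 0 ≠ 0 → X ∈ K := by
    intro X hX
    have : X = eU ((X 0 0 - 1) / X 1 0) * fL (X 1 0) * eU ((X 1 1 - 1) / X 1 0) := by
      have hd := det2 X
      have hb : X 0 1 = (X 0 0 * X 1 1 - 1) / X 1 0 := by
        rw [eq_div_iff hX]; linear_combination -hd
      obtain ⟨a1, a2, a3, a4⟩ := eU_ent ((X 0 0 - 1) / X 1 0)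
      obtain ⟨b1, b2, b3, b4⟩ := eU_ent ((X 1 1 - 1) / X 1 0)
      obtain ⟨d1, d2, d3, d4⟩ := fL_ent (X 1 0)
      apply sl_ext <;> simp only [mul00, mul01, mul10, mul11, a1, a2, a3, a4, b1, b2, b3, b4,
        d1, d2, d3, d4, hb] <;> field_simp <;> ring
    rw [this]
    exact K.mul_mem (K.mul_mem (he _) (hf _)) (he _)
  rw [eq_top_iff]
  intro X _
  by_cases h : X 1 0 = 0
  · have h1 : X * fL 1 ∈ K := by
      apply hc
      obtain ⟨d1, d2, d3, d4⟩ := fL_ent (1 : F)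
      rw [mul10, h, d3]
      intro h0
      have hd := det2 X
      have : X 1 1 = 0 := by linear_combination h0
      rw [this, h] at hd
      simp at hd
    have := K.mul_mem h1 (K.inv_mem (hf 1))
    simpa using this
  · exact hc X h

theorem comm_upper {X Y : SpecialLinearGroup (Fin 2) F} (hX : X 1 0 = 0) (hY : Y 1 0 = 0) :
    ∃ s, Y * X * Y⁻¹ = eU s * X := by
  have h1 := det2 X
  have h2 := det2 Y
  rw [hX] at h1
  rw [hY] at h2
  refine ⟨(Y * X * Y⁻¹ * X⁻¹) 0 1, ?_⟩
  rw [← mul_inv_eq_iff_eq_mul]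
  obtain ⟨a1, a2, a3, a4⟩ := eU_ent ((Y * X * Y⁻¹ * X⁻¹) 0 1)
  apply sl_ext
  · rw [a1]
    simp only [mul00, mul01, mul10, mul11, inv00, inv01, inv10, inv11, hX, hY]
    linear_combination h1 + X 0 0 * X 1 1 * h2
  · rw [a2]
  · rw [a3]
    simp only [mul00, mul01, mul10, mul11, inv00, inv01, inv10, inv11, hX, hY]
    ring
  · rw [a4]
    simp only [mul00, mul01, mul10, mul11, inv00, inv01, inv10, inv11, hX, hY]
    linear_combination h1 + X 0 0 * X 1 1 * h2

theorem a6_aux (H : Subgroup (ProjectiveSpecialLinearGroup (Fin 2) F))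
    (he : ∀ s, ((eU s : SpecialLinearGroup (Fin 2) F) :
      ProjectiveSpecialLinearGroup (Fin 2) F) ∈ H) : IsPronormal H := by
  let π := QuotientGroup.mk' (Subgroup.center (SpecialLinearGroup (Fin 2) F))
  have top_of : ∀ K : Subgroup (ProjectiveSpecialLinearGroup (Fin 2) F), K.comap π = ⊤ →
      ∀ x, x ∈ K := by
    intro K hK x
    obtain ⟨X, rfl⟩ := QuotientGroup.mk_surjective x
    have : X ∈ K.comap π := by rw [hK]; trivial
    exact this
  intro g
  obtain ⟨Y, rfl⟩ := QuotientGroup.mk_surjective g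
  by_cases hY : Y 1 0 = 0
  · by_cases hH : ∃ X : SpecialLinearGroup (Fin 2) F, X 1 0 ≠ 0 ∧
      (X : ProjectiveSpecialLinearGroup (Fin 2) F) ∈ H
    · obtain ⟨X, hX, hXH⟩ := hH
      have h := top_of H (gen_top (H.comap π) he X hX (fun s => by
        have := H.mul_mem (H.mul_mem (H.inv_mem hXH) (he s)) hXH
        exact this))
      exact ⟨Y, Subgroup.mem_sup_left (h _), rfl⟩
    · push Not at hH
      refine ⟨1, one_mem _, ?_⟩
      rw [conjugate_one]
      ext y
      rw [mem_conjugate]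
      obtain ⟨X, rfl⟩ := QuotientGroup.mk_surjective y
      constructor
      · intro hX
        obtain ⟨s, hs⟩ := comm_upper (X := X) (Y := Y) (by
          by_contra h
          exact hH X h hX) hY
        have : ((Y * X * Y⁻¹ : SpecialLinearGroup (Fin 2) F) :
          ProjectiveSpecialLinearGroup (Fin 2) F) ∈ H := by
          rw [hs]; exact H.mul_mem (he s) hX
        exact this
      · intro hX
        obtain ⟨s, hs⟩ := comm_upper (X := Y * X * Y⁻¹) (Y := Y⁻¹) (by
          by_contra h
          exact hH _ h hX) (by rw [inv10, hY, neg_zero])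
        have h2 : X = eU s * (Y * X * Y⁻¹) := by rw [← hs]; group
        rw [h2]
        exact H.mul_mem (he s) hX
  · refine ⟨Y, ?_, rfl⟩
    apply top_of
    refine gen_top _ (fun s => Subgroup.mem_sup_left (he s)) Y hY (fun s => ?_)
    refine Subgroup.mem_sup_right ?_
    rw [mem_conjugate]
    have h2 : ((Y * (Y⁻¹ * eU s * Y) * Y⁻¹ : SpecialLinearGroup (Fin 2) F) :
          ProjectiveSpecialLinearGroup (Fin 2) F) ∈ H := by
      rw [show Y * (Y⁻¹ * eU s * Y) * Y⁻¹ = eU s by group]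
      exact he s
    exact h2

theorem unip_conj {U : SpecialLinearGroup (Fin 2) F} (ht : tr U = 2) :
    ∃ (P : SpecialLinearGroup (Fin 2) F) (β : F), U = P * eU β * P⁻¹ := by
  have hd := det2 U
  unfold tr at ht
  by_cases hc : U 1 0 = 0
  · have ha : U 0 0 = 1 := by
      have : (U 0 0 - 1) ^ 2 = 0 := by
        rw [hc] at hd; linear_combination U 0 0 * ht - hd
      have := pow_eq_zero_iff (two_ne_zero) |>.1 this
      linear_combination this
    refine ⟨1, U 0 1, ?_⟩
    rw [one_mul, inv_one, mul_one]
    obtain ⟨a1, a2, a3, a4⟩ := eU_ent (U 0 1)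
    apply sl_ext
    · rw [a1, ha]
    · rw [a2]
    · rw [a3, hc]
    · rw [a4]; linear_combination ht - ha
  · obtain ⟨P, p1, p2, p3, p4⟩ := exists_sl (U 0 0 - 1) (- 1 / U 1 0) (U 1 0) 0 (by
      field_simp; ring)
    refine ⟨P, -1 / U 1 0, ?_⟩
    rw [eq_mul_inv_iff_mul_eq]
    obtain ⟨a1, a2, a3, a4⟩ := eU_ent (-1 / U 1 0)
    have hD : U 1 1 = 2 - U 0 0 := by linear_combination ht
    have hb : U 0 1 = (U 0 0 * U 1 1 - 1) / U 1 0 := by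
        rw [eq_div_iff hc]; linear_combination -hd
    apply sl_ext <;> simp only [mul00, mul01, mul10, mul11, a1, a2, a3, a4,
        p1, p2, p3, p4, hb, hD] <;> field_simp <;> ring

theorem a6 (q : ℕ) [Fact q.Prime] [Fintype F] [CharP F q] (hF : Fintype.card F = q) (hq2 : q ≠ 2)
    (H : Subgroup (ProjectiveSpecialLinearGroup (Fin 2) F))
    (u : ProjectiveSpecialLinearGroup (Fin 2) F) (huH : u ∈ H) (hu1 : u ≠ 1) (hu : u ^ q = 1) :
    IsPronormal H := by
  obtain ⟨U, rfl, ht⟩ := unip_lift q hq2 u hu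
  obtain ⟨P, β, h⟩ := unip_conj ht
  apply pronormal_of_conjugate (P : ProjectiveSpecialLinearGroup (Fin 2) F)
  apply a6_aux
  have hβ : β ≠ 0 := by
    rintro rfl
    apply hu1
    rw [h, eU_zero]
    simp
  have h1 : ((eU β : SpecialLinearGroup (Fin 2) F) : ProjectiveSpecialLinearGroup (Fin 2) F) ∈
      H.conjugate (P : ProjectiveSpecialLinearGroup (Fin 2) F) := by
    rw [mem_conjugate]
    rw [h] at huH
    exact huH
  intro s
  obtain ⟨m, hm⟩ := (ZMod.castHom_bijective F hF).2 (s / β)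
  have hm' : ((m.val : ℕ) : F) = s / β := by
    rw [← hm, ZMod.castHom_apply, ZMod.natCast_val]
  have h3 : eU s = eU β ^ m.val := by
    rw [eU_pow, hm', div_mul_cancel₀ _ hβ]
  rw [h3, QuotientGroup.mk_pow]
  exact Subgroup.pow_mem _ h1 _

end Mat

section Abstract

/-- The facts about `PSL(2, q)` used in the group-theoretic part of the argument. -/
structure Hyp (G : Type*) [Group G] (q : ℕ) : Prop where
  pq : q.Prime
  q2 : q ≠ 2
  a1 : ∀ x : G, x ^ 4 = 1 → x ^ 2 = 1
  a2 : ∀ x : G, x ^ 2 ≠ 1 → x ^ q ≠ 1 → IsCyclic (Subgroup.centralizer {x})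
  a3 : ∀ x g : G, x ^ 2 ≠ 1 → x ^ q ≠ 1 → g * x * g⁻¹ ∈ Subgroup.zpowers x →
    g * x = x * g ∨ ∀ t, x * t = t * x → g * t * g⁻¹ = t⁻¹
  a4 : ∀ z w y : G, z ^ 2 = 1 → w ^ 2 = 1 → z ≠ 1 → w ≠ 1 → z ≠ w → z * w = w * z →
    z * y = y * z → w * y = y * w → y = 1 ∨ y = z ∨ y = w ∨ y = z * w

variable {G : Type*} [Group G] [Finite G] {q : ℕ}

theorem eq_one_of_coprime {x : G} {a b : ℕ} (hab : Nat.Coprime a b) (ha : x ^ a = 1)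
    (hb : x ^ b = 1) : x = 1 := by
  have := pow_gcd_eq_one.2 ⟨ha, hb⟩
  rwa [hab, pow_one] at this

theorem rgroup_cyclic (h : Hyp G q) {r : ℕ} [hr : Fact r.Prime] (hr2 : r ≠ 2) (hrq : r ≠ q)
    (R : Subgroup G) (hR : IsPGroup r R) : IsCyclic R := by
  by_cases hn : Nontrivial R
  · have := hR.center_nontrivial
    obtain ⟨x, hx⟩ := exists_ne (1 : Subgroup.center R)
    have hx1 : ((x : R) : G) ≠ 1 := by
      intro h1
      apply hx
      ext
      exact h1
    obtain ⟨k, hk⟩ := hR x.1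
    have hk' : ((x : R) : G) ^ (r ^ k) = 1 := by
      have := congrArg (Subtype.val) hk
      simpa using this
    have hcy := h.a2 ((x : R) : G) (fun h2 => hx1 (eq_one_of_coprime
        (Nat.Coprime.pow_left k ((Nat.coprime_primes hr.out Nat.prime_two).2 hr2)) hk' h2))
      (fun h2 => hx1 (eq_one_of_coprime
        (Nat.Coprime.pow_left k ((Nat.coprime_primes hr.out h.pq).2 hrq)) hk' h2))
    have hle : R ≤ Subgroup.centralizer {((x : R) : G)} := by
      intro y hy
      rw [Subgroup.mem_centralizer_singleton_iff]
      have := (Subgroup.mem_center_iff.1 x.2) ⟨y, hy⟩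
      exact congrArg Subtype.val this
    exact isCyclic_of_injective (Subgroup.inclusion hle) (Subgroup.inclusion_injective hle)
  · rw [not_nontrivial_iff_subsingleton] at hn
    infer_instance

theorem cyclic_unique {S P₁ P₂ : Subgroup G} (hS : IsCyclic S) (h1 : P₁ ≤ S) (h2 : P₂ ≤ S)
    (hc : Nat.card P₁ = Nat.card P₂) : P₁ = P₂ := by
  classical
  have : Fintype S := Fintype.ofFinite S
  set r := Nat.card P₁ with hr
  have hr0 : 0 < r := Nat.card_pos
  have hA : ({a : S | a ^ r = 1} : Set S).ncard ≤ r := by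
    have := IsCyclic.card_pow_eq_one_le (α := S) hr0
    rw [← Set.ncard_coe_finset] at this
    simpa using this
  have key : ∀ P : Subgroup G, P ≤ S → Nat.card P = r →
      ((P.subgroupOf S : Subgroup S) : Set S) = {a : S | a ^ r = 1} := by
    intro P hP hPr
    refine Set.eq_of_subset_of_ncard_le ?_ ?_ (Set.toFinite _)
    · intro a ha
      have ha' : (a : G) ∈ P := by simpa [Subgroup.mem_subgroupOf] using ha
      have := pow_card_eq_one' (x := (⟨a, ha'⟩ : P))
      rw [hPr] at this
      ext
      simpa using congrArg Subtype.val this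
    · refine hA.trans ?_
      rw [← hPr, ← Nat.card_congr (Subgroup.subgroupOfEquivOfLe hP).toEquiv]
      exact le_of_eq (Nat.card_coe_set_eq _)
  have hk : P₁.subgroupOf S = P₂.subgroupOf S := by
    apply SetLike.coe_injective
    rw [key P₁ h1 rfl, key P₂ h2 hc.symm]
  have := (Subgroup.subgroupOf_inj).1 hk
  rwa [inf_eq_left.2 h1, inf_eq_left.2 h2] at this

theorem conj_eq_of {H : Subgroup G} {g : G} (h : ∀ y ∈ H, g * y * g⁻¹ ∈ H) :
    H.conjugate g = H := by
  symm
  apply Subgroup.eq_of_le_of_card_ge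
  · intro y hy
    rw [mem_conjugate]
    exact h y hy
  · rw [card_conjugate]

theorem odd_order_sq (h : Hyp G q) (t : G) : ∃ n : ℕ, ((t ^ 2) ^ n) ^ 2 = t ^ 2 := by
  have hm : ¬ 2 ∣ orderOf (t ^ 2) := by
    rintro ⟨k, hk⟩
    have h0 : 0 < orderOf (t ^ 2) := orderOf_pos _
    have h4 : (t ^ k) ^ 4 = 1 := by
      have := pow_orderOf_eq_one (t ^ 2)
      rw [hk, ← pow_mul] at this
      rw [← pow_mul, ← this]
      congr 1
      ring
    have := h.a1 _ h4
    have h5 : (t ^ 2) ^ k = 1 := by rw [← this, ← pow_mul, ← pow_mul, mul_comm]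
    have := orderOf_le_of_pow_eq_one (by omega) h5
    omega
  refine ⟨(orderOf (t ^ 2) + 1) / 2, ?_⟩
  rw [← pow_mul, Nat.div_mul_cancel (by omega), pow_succ, pow_orderOf_eq_one, one_mul]

theorem conj_pow_mem {x g : G} (hx : g * x * g⁻¹ ∈ Subgroup.zpowers x) (n : ℕ) :
    g * x ^ n * g⁻¹ ∈ Subgroup.zpowers (x ^ n) := by
  obtain ⟨k, hk⟩ := hx
  refine ⟨k, ?_⟩
  rw [← conj_pow, ← hk]
  show (x ^ n) ^ k = (x ^ k) ^ n
  rw [← zpow_natCast, ← zpow_natCast, ← zpow_mul, ← zpow_mul, mul_comm]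

/-- A subgroup with a normal subgroup of odd prime order different from `q` is pronormal. -/
theorem lemB (h : Hyp G q) {r : ℕ} [hr : Fact r.Prime] (hr2 : r ≠ 2) (hrq : r ≠ q)
    {H : Subgroup G} {y : G} (hyr : y ^ r = 1) (hy1 : y ≠ 1) (hyH : y ∈ H)
    (hN : ∀ g ∈ H, g * y * g⁻¹ ∈ Subgroup.zpowers y) : IsPronormal H := by
  have hy2 : y ^ 2 ≠ 1 := fun h2 =>
    hy1 (eq_one_of_coprime ((Nat.coprime_primes hr.out Nat.prime_two).2 hr2) hyr h2)
  have hyq : y ^ q ≠ 1 := fun h2 =>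
    hy1 (eq_one_of_coprime ((Nat.coprime_primes hr.out h.pq).2 hrq) hyr h2)
  have hord : orderOf y = r := orderOf_eq_prime hyr hy1
  have hcard : Nat.card (Subgroup.zpowers y) = r := by rw [Nat.card_zpowers, hord]
  have hP : IsPGroup r (Subgroup.zpowers y) := IsPGroup.of_card (n := 1) (by rw [hcard, pow_one])
  have hcy := h.a2 y hy2 hyq
  have hcomm : ∀ s t, y * s = s * y → y * t = t * y → s * t = t * s := by
    intro s t hs ht
    let _ := hcy.commGroup
    have := mul_comm (⟨s, Subgroup.mem_centralizer_singleton_iff.2 hs.symm⟩ :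
      Subgroup.centralizer {y}) ⟨t, Subgroup.mem_centralizer_singleton_iff.2 ht.symm⟩
    exact congrArg Subtype.val this
  refine pronormal_of_le (P := Subgroup.zpowers y) (by simpa using hyH) ?_ ?_
  · refine pronormal_of_unique hP ?_
    intro S P₁ P₂ hS h1 h2 c1 c2
    exact cyclic_unique (rgroup_cyclic h hr2 hrq S hS) h1 h2 (c1.trans c2.symm)
  intro g hg
  have hgy : g * y * g⁻¹ ∈ Subgroup.zpowers y := by
    rw [← mem_conjugate, hg]
    exact Subgroup.mem_zpowers y
  by_cases hT : ∀ s ∈ H, y * s = s * y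
  · refine ⟨1, one_mem _, ?_⟩
    rw [conjugate_one, eq_comm]
    apply conj_eq_of
    intro s hs
    rcases h.a3 y g hy2 hyq hgy with h1 | h1
    · rw [hcomm g s h1.symm (hT s hs)]
      simpa using hs
    · rw [h1 s (hT s hs)]
      exact H.inv_mem hs
  · push Not at hT
    obtain ⟨s, hsH, hs⟩ := hT
    have hinv : ∀ n ∈ H, y * n ≠ n * y → ∀ t, y * t = t * y → n * t * n⁻¹ = t⁻¹ := by
      intro n hn hne
      rcases h.a3 y n hy2 hyq (hN n hn) with h1 | h1
      · exact absurd h1.symm hne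
      · exact h1
    have claim : ∀ t, y * t = t * y →
        ∃ x ∈ (H ⊔ H.conjugate t : Subgroup G), H.conjugate x = H.conjugate t := by
      intro t ht
      have h1 := hinv s hsH hs t ht
      have h2 : t⁻¹ * s * t ∈ H.conjugate t := by
        rw [mem_conjugate]
        simpa [mul_assoc] using hsH
      have h3 : t ^ 2 ∈ H ⊔ H.conjugate t := by
        have h4 : t ^ 2 = s * (t⁻¹ * s * t)⁻¹ := by
          have : s * t = t⁻¹ * s := by rw [← h1]; group
          rw [mul_assoc, this]
          group
        rw [h4]
        exact Subgroup.mul_mem _ (Subgroup.mem_sup_left hsH)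
          (Subgroup.inv_mem _ (Subgroup.mem_sup_right h2))
      obtain ⟨n, hn⟩ := odd_order_sq h t
      refine ⟨(t ^ 2) ^ n, Subgroup.pow_mem _ h3 n, ?_⟩
      set x := (t ^ 2) ^ n with hx
      have hxt : x * t = t * x := by
        rw [hx, ← pow_mul]
        exact (Commute.pow_self t _)
      have hyx : y * x = x * y := by
        rw [hx, ← pow_mul]
        exact (Commute.pow_right (show Commute y t from ht) _)
      have hxi : t * x⁻¹ = x⁻¹ * t := by
        have : Commute x t := hxt
        exact this.symm.inv_right
      have hc2 : (t * x⁻¹) ^ 2 = 1 := by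
        have : Commute t x⁻¹ := hxi
        rw [this.mul_pow, inv_pow, hn, mul_inv_cancel]
      have hyc : y * (t * x⁻¹) = (t * x⁻¹) * y := by
        have a : Commute y t := ht
        have b : Commute y x := hyx
        exact a.mul_right b.inv_right
      have hH : H.conjugate (t * x⁻¹) = H := by
        apply conj_eq_of
        intro z hz
        have : (t * x⁻¹) * z = z * (t * x⁻¹) := by
          by_cases hyz : y * z = z * y
          · exact hcomm _ _ hyc hyz
          · have h5 := hinv z hz hyz _ hyc
            have h6 : (t * x⁻¹)⁻¹ = t * x⁻¹ := by
              rw [inv_eq_iff_mul_eq_one, ← pow_two, hc2]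
            rw [h6] at h5
            rw [mul_inv_eq_iff_eq_mul] at h5
            exact h5.symm
        rw [this, mul_inv_cancel_right]
        exact hz
      calc H.conjugate x = (H.conjugate (t * x⁻¹)).conjugate x := by rw [hH]
        _ = H.conjugate t := by rw [← conjugate_mul]; congr 1; group
    rcases h.a3 y g hy2 hyq hgy with h1 | h1
    · exact claim g h1.symm
    · have h2 : H.conjugate g = H.conjugate (s⁻¹ * g) := by
        rw [conjugate_mul, conjugate_of_mem (H.inv_mem hsH)]
      rw [h2]
      apply claim
      have h3 := h1 y rfl
      have h4 := hinv s hsH hs y rfl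
      have h5 : g * y * g⁻¹ = s * y * s⁻¹ := by rw [h3, h4]
      have h6 : g * y = s * y * s⁻¹ * g := by rw [← h5]; group
      rw [mul_assoc s⁻¹, h6]
      group

theorem two_pow (h : Hyp G q) {x : G} (k : ℕ) (hx : x ^ (2 ^ k) = 1) : x ^ 2 = 1 := by
  induction k with
  | zero => simp at hx; simp [hx]
  | succ k ih =>
    rcases k with _ | k
    · simpa using hx
    · apply ih
      have : (x ^ (2 ^ k)) ^ 4 = 1 := by
        rw [← pow_mul, ← hx]
        congr 1
        ring
      have := h.a1 _ this
      rw [← pow_mul] at this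
      rw [pow_succ]
      exact this

theorem lemB' (h : Hyp G q) {H : Subgroup G} (hq : ∀ u ∈ H, u ^ q = 1 → u = 1) {x : G}
    (hxH : x ∈ H) (hx2 : x ^ 2 ≠ 1) (hN : ∀ g ∈ H, g * x * g⁻¹ ∈ Subgroup.zpowers x) :
    IsPronormal H := by
  have h0 : orderOf x ≠ 0 := (orderOf_pos x).ne'
  have : ∃ r, r.Prime ∧ r ∣ orderOf x ∧ r ≠ 2 := by
    by_contra hcon
    push Not at hcon
    have := Nat.eq_prime_pow_of_unique_prime_dvd h0 (p := 2) (fun {d} hd hdx => hcon d hd hdx)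
    apply hx2
    apply two_pow h (orderOf x).primeFactorsList.length
    rw [← this]
    exact pow_orderOf_eq_one x
  obtain ⟨r, hr, hrx, hr2⟩ := this
  have := Fact.mk hr
  have hor := orderOf_pow_orderOf_div h0 hrx
  have hy1 : x ^ (orderOf x / r) ≠ 1 := by
    intro h1
    rw [h1, orderOf_one] at hor
    exact hr.one_lt.ne hor
  have hyr : (x ^ (orderOf x / r)) ^ r = 1 := by
    have h1 := pow_orderOf_eq_one (x ^ (orderOf x / r))
    rwa [hor] at h1
  refine lemB h hr2 ?_ hyr hy1 (H.pow_mem hxH _) (fun g hg => conj_pow_mem (hN g hg) _)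
  rintro rfl
  exact hy1 (hq _ (H.pow_mem hxH _) hyr)


theorem isZ (h : Hyp G q) {H : Subgroup G} (hq : ∀ u ∈ H, u ^ q = 1 → u = 1)
    (h4 : ¬ 4 ∣ Nat.card H) : IsZGroup H := by
  refine ⟨fun p hp P => ?_⟩
  have := Fact.mk hp
  by_cases hpq : p = q
  · subst hpq
    have hs : Subsingleton P := by
      by_contra hn
      rw [not_subsingleton_iff_nontrivial] at hn
      obtain ⟨n, hn0, hn⟩ := P.2.nontrivial_iff_card.1 hn
      obtain ⟨x, hx⟩ := exists_prime_orderOf_dvd_card' (G := P) p (by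
        have : p ∣ Nat.card (P : Subgroup H) := by
          rw [hn]; exact dvd_pow_self p hn0.ne'
        exact this)
      have hx1 : x ^ p = 1 := orderOf_dvd_iff_pow_eq_one.1 (dvd_of_eq hx)
      have h1 := hq x.1.1 x.1.2 (by
        have := congrArg (fun y : P => ((y : H) : G)) hx1
        simpa using this)
      have : x = 1 := by
        apply Subtype.ext
        apply Subtype.ext
        exact h1
      rw [this, orderOf_one] at hx
      exact hp.one_lt.ne hx
    infer_instance
  by_cases hp2 : p = 2
  · subst hp2
    obtain ⟨n, hn⟩ := IsPGroup.iff_card.1 P.2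
    have hd : 2 ^ n ∣ Nat.card H := by
      rw [← hn]; exact Subgroup.card_subgroup_dvd_card _
    have hn2 : n < 2 := by
      by_contra hc
      exact h4 ((pow_dvd_pow 2 (show 2 ≤ n by omega)).trans hd)
    interval_cases n
    · have : Nat.card P = 1 := hn
      have := (Nat.card_eq_one_iff_unique.1 this).1
      infer_instance
    · exact isCyclic_of_prime_card (p := 2) hn
  · have hm : IsPGroup p ((P : Subgroup H).map H.subtype) := P.2.map _
    have := rgroup_cyclic h hp2 hpq _ hm
    exact isCyclic_of_injective
      ((P : Subgroup H).equivMapOfInjective H.subtype H.subtype_injective).toMonoidHom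
      (MulEquiv.injective _)

theorem lemC (H : Subgroup G) (hZ : IsZGroup H) :
    (∀ x ∈ H, x ^ 2 = 1) ∨ ∃ x ∈ H, x ^ 2 ≠ 1 ∧ ∀ g ∈ H, g * x * g⁻¹ ∈ Subgroup.zpowers x := by
  have hcy := IsZGroup.isCyclic_commutator H
  obtain ⟨x, hx⟩ := hcy.exists_generator
  have hconj : ∀ g : H, g * x.1 * g⁻¹ ∈ Subgroup.zpowers x.1 := by
    intro g
    have h1 : g * x.1 * g⁻¹ ∈ commutator H := Subgroup.Normal.conj_mem inferInstance _ x.2 g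
    obtain ⟨k, hk⟩ := hx ⟨_, h1⟩
    refine ⟨k, ?_⟩
    simpa using congrArg Subtype.val hk
  by_cases hx2 : ((x.1 : H) : G) ^ 2 = 1
  · have hx2' : x.1 ^ 2 = 1 := by
      ext; simpa using hx2
    have hcen : commutator H ≤ Subgroup.center H := by
      have hxc : x.1 ∈ Subgroup.center H := by
        rw [Subgroup.mem_center_iff]
        intro g
        obtain ⟨k, hk⟩ := hconj g
        have hk' : x.1 ^ k = g * x.1 * g⁻¹ := hk
        rcases Int.even_or_odd' k with ⟨m, rfl | rfl⟩
        · rw [zpow_mul] at hk'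
          have : x.1 ^ (2 : ℤ) = 1 := by exact_mod_cast hx2'
          rw [this, one_zpow] at hk'
          have : x.1 = 1 := by
            rw [eq_comm, mul_inv_eq_one] at hk'
            simpa using hk'
          rw [this]; simp
        · rw [zpow_add, zpow_mul, zpow_one] at hk'
          have : x.1 ^ (2 : ℤ) = 1 := by exact_mod_cast hx2'
          rw [this, one_zpow, one_mul, eq_mul_inv_iff_mul_eq] at hk'
          exact hk'.symm
      intro y hy
      obtain ⟨k, hk⟩ := hx ⟨y, hy⟩
      have : x.1 ^ k = y := by simpa using congrArg Subtype.val hk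
      rw [← this]
      exact Subgroup.zpow_mem _ hxc k
    have hnil : Group.IsNilpotent H := by
      rw [Subgroup.nilpotent_iff_lowerCentralSeries]
      exact ⟨2, Subgroup.lowerCentralSeries_succ_eq_bot ⊤ hcen⟩
    have hHc : IsCyclic H := inferInstance
    obtain ⟨y, hy⟩ := hHc.exists_generator
    have hy' : ∀ g ∈ H, ∃ k : ℤ, (y : G) ^ k = g := by
      intro g hg
      obtain ⟨k, hk⟩ := hy ⟨g, hg⟩
      exact ⟨k, by simpa using congrArg Subtype.val hk⟩
    by_cases hy2 : (y : G) ^ 2 = 1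
    · left
      intro g hg
      obtain ⟨k, rfl⟩ := hy' g hg
      rw [← zpow_natCast, ← zpow_mul, mul_comm, zpow_mul, zpow_natCast, hy2, one_zpow]
    · right
      refine ⟨y, y.2, hy2, ?_⟩
      intro g hg
      obtain ⟨k, rfl⟩ := hy' g hg
      have : (y : G) ^ k * y * ((y : G) ^ k)⁻¹ = y := by
        rw [(Commute.zpow_self (y : G) k).eq]; group
      rw [this]
      exact Subgroup.mem_zpowers _
  · right
    refine ⟨_, x.1.2, hx2, ?_⟩
    intro g hg
    obtain ⟨k, hk⟩ := hconj ⟨g, hg⟩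
    exact ⟨k, by simpa using congrArg Subtype.val hk⟩

theorem pronormal_bot : IsPronormal (⊥ : Subgroup G) := by
  intro g
  refine ⟨1, one_mem _, ?_⟩
  rw [conjugate_one, eq_comm]
  apply conj_eq_of
  intro y hy
  rw [Subgroup.mem_bot] at *
  simp [hy]

theorem case_not4 (h : Hyp G q) {H : Subgroup G} (hq : ∀ u ∈ H, u ^ q = 1 → u = 1)
    (h4 : ¬ 4 ∣ Nat.card H) (h2 : Nat.card H ≠ 2) : IsPronormal H := by
  rcases lemC H (isZ h hq h4) with h1 | ⟨x, hxH, hx2, hN⟩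
  · have hP : IsPGroup 2 H := by
      intro x
      refine ⟨1, ?_⟩
      ext
      simpa using h1 x.1 x.2
    obtain ⟨n, hn⟩ := IsPGroup.iff_card.1 hP
    have hn2 : n < 2 := by
      by_contra hc
      rw [hn] at h4
      exact h4 ((pow_dvd_pow 2 (show 2 ≤ n by omega)))
    interval_cases n
    · rw [Subgroup.eq_bot_of_card_eq H (by simpa using hn)]
      exact pronormal_bot
    · simp at hn
      exact absurd hn h2
  · exact lemB' h hq hxH hx2 hN

theorem sq_one (h : Hyp G q) {S : Subgroup G} (hS : IsPGroup 2 S) : ∀ v ∈ S, v ^ 2 = 1 := by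
  intro v hv
  obtain ⟨k, hk⟩ := hS ⟨v, hv⟩
  apply two_pow h k
  simpa using congrArg Subtype.val hk

theorem comm_of_sq {S : Subgroup G} (hS : ∀ v ∈ S, v ^ 2 = 1) : ∀ a ∈ S, ∀ b ∈ S,
    a * b = b * a := by
  intro a ha b hb
  have h1 := hS a ha
  have h2 := hS b hb
  have h3 := hS _ (S.mul_mem ha hb)
  have e : ∀ v : G, v ^ 2 = 1 → v⁻¹ = v := by
    intro v hv
    rw [inv_eq_iff_mul_eq_one, ← pow_two, hv]
  have := e _ h3
  rw [mul_inv_rev, e a h1, e b h2] at this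
  exact this.symm

theorem exists_second {P : Subgroup G} (hP : ∀ v ∈ P, v ^ 2 = 1) (hc : 2 < Nat.card P) (z : G) :
    ∃ w ∈ P, w ≠ 1 ∧ w ≠ z := by
  by_contra hcon
  push Not at hcon
  by_cases hz : z ∈ P
  · have hle : P ≤ Subgroup.zpowers z := by
      intro w hw
      by_cases h1 : w = 1
      · rw [h1]; exact one_mem _
      · rw [hcon w hw h1]; exact Subgroup.mem_zpowers z
    have h1 := Subgroup.card_le_of_le hle
    rw [Nat.card_zpowers] at h1
    have := orderOf_le_of_pow_eq_one (by norm_num) (hP z hz)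
    omega
  · have : P = ⊥ := by
      rw [Subgroup.eq_bot_iff_forall]
      intro w hw
      by_contra h1
      exact hz (hcon w hw h1 ▸ hw)
    rw [this, Subgroup.card_bot] at hc
    omega

/-- Elements centralizing two distinct involutions of a four-group lie in it. -/
theorem four_cent (h : Hyp G q) {P : Subgroup G} (hP : ∀ v ∈ P, v ^ 2 = 1) {z w y : G}
    (hz : z ∈ P) (hw : w ∈ P) (hz1 : z ≠ 1) (hw1 : w ≠ 1) (hzw : z ≠ w)
    (h1 : z * y = y * z) (h2 : w * y = y * w) : y ∈ P := by
  rcases h.a4 z w y (hP z hz) (hP w hw) hz1 hw1 hzw (comm_of_sq hP z hz w hw) h1 h2 with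
    rfl | rfl | rfl | rfl
  · exact one_mem _
  · exact hz
  · exact hw
  · exact P.mul_mem hz hw

theorem four_max (h : Hyp G q) {S P : Subgroup G} (hS : IsPGroup 2 S) (hPS : P ≤ S)
    (hc : 2 < Nat.card P) : P = S := by
  apply le_antisymm hPS
  have hs := sq_one h hS
  have hp : ∀ v ∈ P, v ^ 2 = 1 := fun v hv => hs v (hPS hv)
  obtain ⟨z, hz, hz1, -⟩ := exists_second hp hc 1
  obtain ⟨w, hw, hw1, hwz⟩ := exists_second hp hc z
  intro y hy
  exact four_cent h hp hz hw hz1 hw1 hwz.symm (comm_of_sq hs z (hPS hz) y hy)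
    (comm_of_sq hs w (hPS hw) y hy)

theorem four_pronormal (h : Hyp G q) {P : Subgroup G} (hP : IsPGroup 2 P)
    (hc : 2 < Nat.card P) : IsPronormal P := by
  refine pronormal_of_unique hP ?_
  intro S P₁ P₂ hS h1 h2 c1 c2
  rw [four_max h hS h1 (by omega), four_max h hS h2 (by omega)]

/-- An element normalizing a four-group and centralizing an involution in it lies in it. -/
theorem four_fix (h : Hyp G q) {P : Subgroup G} (hP : ∀ v ∈ P, v ^ 2 = 1)
    (hc : 2 < Nat.card P) {n z : G} (hn : ∀ v ∈ P, n * v * n⁻¹ ∈ P) (hz : z ∈ P) (hz1 : z ≠ 1)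
    (hnz : n * z * n⁻¹ = z) : n ∈ P := by
  obtain ⟨w, hw, hw1, hwz⟩ := exists_second hP hc z
  have hcom := comm_of_sq hP
  have hnz' : z * n = n * z := by rw [mul_inv_eq_iff_eq_mul] at hnz; exact hnz.symm
  have hz2 : z * z = 1 := by rw [← pow_two]; exact hP z hz
  rcases h.a4 z w (n * w * n⁻¹) (hP z hz) (hP w hw) hz1 hw1 hwz.symm (hcom z hz w hw)
    (hcom z hz _ (hn w hw)) (hcom w hw _ (hn w hw)) with h1 | h1 | h1 | h1
  · exfalso
    apply hw1
    rw [mul_inv_eq_one] at h1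
    simpa using h1
  · exfalso
    apply hwz
    rw [← hnz] at h1
    simpa using h1
  · rw [mul_inv_eq_iff_eq_mul] at h1
    exact four_cent h hP hz hw hz1 hw1 hwz.symm hnz' h1.symm
  · exfalso
    rw [mul_inv_eq_iff_eq_mul] at h1
    have h2 : w * (n * n) = (n * n) * w := by
      calc w * (n * n) = z * z * w * (n * n) := by rw [hz2, one_mul]
        _ = z * (z * w * n) * n := by group
        _ = z * n * w * n := by rw [← h1]; group
        _ = n * (z * w * n) := by rw [hnz']; group
        _ = (n * n) * w := by rw [← h1]; group
    have h3 : n * n ∈ P := by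
      refine four_cent h hP hz hw hz1 hw1 hwz.symm ?_ h2
      rw [← mul_assoc, hnz', mul_assoc, hnz', mul_assoc]
    have h4 : n ^ 2 = 1 := by
      apply h.a1
      rw [show n ^ 4 = (n * n) ^ 2 by rw [← pow_two, ← pow_mul]]
      exact hP _ h3
    have h5 : (n * w) ^ 2 = z := by
      calc (n * w) ^ 2 = (n * w) * n * w := by rw [pow_two]; group
        _ = z * w * (n ^ 2) * w := by rw [h1]; simp only [pow_two, mul_assoc]
        _ = z * w ^ 2 := by rw [h4]; simp only [pow_two, mul_assoc, mul_one, one_mul]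
        _ = z := by rw [hP w hw, mul_one]
    have h6 := h.a1 (n * w) (by
      rw [show (n * w) ^ 4 = ((n * w) ^ 2) ^ 2 by rw [← pow_mul], h5]
      exact hP z hz)
    exact hz1 (h5.symm.trans h6)

theorem four_norm (h : Hyp G q) {P : Subgroup G} (hP : ∀ v ∈ P, v ^ 2 = 1)
    (hc : 2 < Nat.card P) {n g : G} (hn : ∀ v ∈ P, n * v * n⁻¹ ∈ P) (hnP : n ∉ P)
    (hn' : ∀ v ∈ P, n⁻¹ * v * n ∈ P)
    (hg : ∀ v ∈ P, g * v * g⁻¹ ∈ P) : g ∈ P ∨ n⁻¹ * g ∈ P ∨ (n⁻¹ * (n⁻¹ * g)) ∈ P := by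
  obtain ⟨z, hz, hz1, -⟩ := exists_second hP hc 1
  have hcom := comm_of_sq hP
  set z' := n * z * n⁻¹ with hz'
  have hz'P : z' ∈ P := hn z hz
  have hz'1 : z' ≠ 1 := by
    intro h1
    apply hz1
    rw [hz', mul_inv_eq_one] at h1
    simpa using h1
  have hzz' : z ≠ z' := fun h1 => hnP (four_fix h hP hc hn hz hz1 h1.symm)
  have hz'z'' : z' ≠ n * z' * n⁻¹ := by
    intro h1
    exact hnP (four_fix h hP hc hn hz'P hz'1 h1.symm)
  have hzz1 : z * z' ≠ 1 := by
    intro h1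
    apply hzz'
    have h2 := hP z hz
    rw [pow_two, ← h1] at h2
    simpa using h2
  have hz'' : n * z' * n⁻¹ = z * z' := by
    rcases h.a4 z z' (n * z' * n⁻¹) (hP z hz) (hP z' hz'P) hz1 hz'1 hzz' (hcom z hz z' hz'P)
      (hcom z hz _ (hn z' hz'P)) (hcom z' hz'P _ (hn z' hz'P)) with h1 | h1 | h1 | h1
    · exfalso
      apply hz'1
      rw [mul_inv_eq_one] at h1
      simpa using h1
    · exfalso
      apply hnP
      refine four_fix h hP hc hn (P.mul_mem hz hz'P) hzz1 ?_
      rw [show n * (z * z') * n⁻¹ = (n * z * n⁻¹) * (n * z' * n⁻¹) by group, ← hz', h1]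
      exact hcom z' hz'P z hz
    · exact absurd h1.symm hz'z''
    · exact h1
  have hgz1 : g * z * g⁻¹ ≠ 1 := by
    intro h1
    apply hz1
    rw [mul_inv_eq_one] at h1
    simpa using h1
  rcases h.a4 z z' (g * z * g⁻¹) (hP z hz) (hP z' hz'P) hz1 hz'1 hzz' (hcom z hz z' hz'P)
      (hcom z hz _ (hg z hz)) (hcom z' hz'P _ (hg z hz)) with h1 | h1 | h1 | h1
  · exact absurd h1 hgz1
  · exact Or.inl (four_fix h hP hc hg hz hz1 h1)
  · refine Or.inr (Or.inl (four_fix h hP hc ?_ hz hz1 ?_))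
    · intro v hv
      have := hn' _ (hg v hv)
      rwa [show n⁻¹ * (g * v * g⁻¹) * n = n⁻¹ * g * v * (n⁻¹ * g)⁻¹ by group] at this
    · rw [show n⁻¹ * g * z * (n⁻¹ * g)⁻¹ = n⁻¹ * (g * z * g⁻¹) * n by group, h1, hz']
      group
  · refine Or.inr (Or.inr (four_fix h hP hc ?_ hz hz1 ?_))
    · intro v hv
      have := hn' _ (hn' _ (hg v hv))
      simpa only [mul_inv_rev, inv_inv, mul_assoc] using this
    · have h2 : n⁻¹ * (n⁻¹ * (g * z * g⁻¹) * n) * n = z := by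
        rw [h1, ← hz'', hz']
        group
      simpa only [mul_inv_rev, inv_inv, mul_assoc] using h2

theorem oddM (h : Hyp G q) {H M : Subgroup G} (hq : ∀ u ∈ H, u ^ q = 1 → u = 1) (hMH : M ≤ H)
    (hM2 : ¬ 2 ∣ Nat.card M) (hM : M ≠ ⊥) (hN : ∀ g ∈ H, ∀ m ∈ M, g * m * g⁻¹ ∈ M) :
    IsPronormal H := by
  have hqM : ∀ u ∈ M, u ^ q = 1 → u = 1 := fun u hu => hq u (hMH hu)
  have hpow : ∀ m ∈ M, m ^ Nat.card M = 1 := by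
    intro m hm
    have := pow_card_eq_one' (x := (⟨m, hm⟩ : M))
    exact congrArg Subtype.val this
  have h4 : ¬ 4 ∣ Nat.card M := fun h4 => hM2 (dvd_trans (by norm_num) h4)
  have hcop : Nat.Coprime 2 (Nat.card M) := (Nat.Prime.coprime_iff_not_dvd Nat.prime_two).2 hM2
  rcases lemC M (isZ h hqM h4) with h1 | ⟨x, hxM, hx2, hxN⟩
  · exfalso
    apply hM
    rw [Subgroup.eq_bot_iff_forall]
    intro x hx
    exact eq_one_of_coprime hcop (h1 x hx) (hpow x hx)
  · have hxq : x ^ q ≠ 1 := by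
      intro h1
      apply hx2
      rw [hqM x hxM h1, one_pow]
    have hcx : ∀ m ∈ M, m * x = x * m := by
      intro m hm
      rcases h.a3 x m hx2 hxq (hxN m hm) with h1 | h1
      · exact h1
      · have h2 := h1 x rfl
        rw [mul_inv_eq_iff_eq_mul] at h2
        have h3 : Commute (m ^ 2) x := by
          show m ^ 2 * x = x * m ^ 2
          have h5 : m * x⁻¹ = x * m := by
            have h6 : x * (m * x) = m := by rw [h2]; group
            calc m * x⁻¹ = x * (m * x) * x⁻¹ := by rw [h6]
              _ = x * m := by group
          rw [pow_two, mul_assoc, h2, ← mul_assoc, h5, mul_assoc]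
        have h4 : m = (m ^ 2) ^ ((Nat.card M + 1) / 2) := by
          rw [← pow_mul, Nat.mul_div_cancel' (by omega), pow_succ, hpow m hm, one_mul]
        rw [h4]
        exact h3.pow_left _
    have hle : M ≤ Subgroup.centralizer {x} := by
      intro m hm
      rw [Subgroup.mem_centralizer_singleton_iff]
      exact hcx m hm
    have := h.a2 x hx2 hxq
    have hcy : IsCyclic M :=
      isCyclic_of_injective (Subgroup.inclusion hle) (Subgroup.inclusion_injective hle)
    obtain ⟨y, hy⟩ := hcy.exists_generator
    have hy' : ∀ g ∈ M, ∃ k : ℤ, (y : G) ^ k = g := by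
      intro g hg
      obtain ⟨k, hk⟩ := hy ⟨g, hg⟩
      exact ⟨k, by simpa using congrArg Subtype.val hk⟩
    refine lemB' h hq (hMH y.2) ?_ (fun g hg => hy' _ (hN g hg y y.2))
    intro hy2
    obtain ⟨k, hk⟩ := hy' x hxM
    apply hx2
    rw [← hk, ← zpow_natCast, ← zpow_mul, mul_comm, zpow_mul, zpow_natCast, hy2, one_zpow]

theorem case_four (h : Hyp G q) {H : Subgroup G} (hq : ∀ u ∈ H, u ^ q = 1 → u = 1)
    (h4 : 4 ∣ Nat.card H) : IsPronormal H := by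
  have := Fact.mk Nat.prime_two
  obtain ⟨V⟩ : Nonempty (Sylow 2 H) := inferInstance
  set P : Subgroup G := (V : Subgroup H).map H.subtype with hPdef
  have hPg : IsPGroup 2 P := V.2.map _
  have hcard : 2 < Nat.card P := by
    rw [hPdef, ← Nat.card_congr
      ((V : Subgroup H).equivMapOfInjective H.subtype H.subtype_injective).toEquiv]
    have h1 := V.card_eq_multiplicity
    have h2 : 2 ≤ (Nat.card H).factorization 2 :=
      (Nat.Prime.pow_dvd_iff_le_factorization Nat.prime_two Nat.card_pos.ne').1 h4
    have h3 : 2 ^ 2 ≤ 2 ^ (Nat.card H).factorization 2 := Nat.pow_le_pow_right (by norm_num) h2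
    rw [← h1] at h3
    omega
  have hPH : P ≤ H := Subgroup.map_subtype_le _
  have hsq := sq_one h hPg
  have hpro := four_pronormal h hPg hcard
  by_cases hcase : ∃ n ∈ H, (∀ v ∈ P, n * v * n⁻¹ ∈ P) ∧ n ∉ P
  · obtain ⟨n, hnH, hn, hnP⟩ := hcase
    refine pronormal_of_le hPH hpro ?_
    intro g hg
    have hg' : ∀ v ∈ P, g * v * g⁻¹ ∈ P := by
      intro v hv
      rw [← mem_conjugate, hg]
      exact hv
    have hn' : ∀ v ∈ P, n⁻¹ * v * n ∈ P := by
      intro v hv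
      rw [← conj_eq_of hn, mem_conjugate]
      simpa [mul_assoc] using hv
    have hgH : g ∈ H := by
      rcases four_norm h hsq hcard hn hnP hn' hg' with h1 | h1 | h1
      · exact hPH h1
      · have := H.mul_mem hnH (hPH h1)
        simpa using this
      · have := H.mul_mem hnH (H.mul_mem hnH (hPH h1))
        simpa using this
    exact ⟨1, one_mem _, by rw [conjugate_one, conjugate_of_mem hgH]⟩
  · push Not at hcase
    have hVP : ∀ v : H, v ∈ V ↔ (v : G) ∈ P := by
      intro v
      constructor
      · intro hv
        exact ⟨v, hv, rfl⟩
      · rintro ⟨w, hw, hwv⟩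
        have : w = v := Subtype.ext hwv
        rw [← this]
        exact hw
    have hV : Subgroup.normalizer (V : Set H) ≤ Subgroup.centralizer (V : Set H) := by
      intro n hn
      have hnP : (n : G) ∈ P := by
        apply hcase n n.2
        rintro v ⟨w, hw, rfl⟩
        exact ⟨n * w * n⁻¹, (Subgroup.mem_normalizer_iff.1 hn w).1 hw, by simp⟩
      rw [Subgroup.mem_centralizer_iff]
      intro w hw
      ext
      exact comm_of_sq hsq w ((hVP w).1 hw) n hnP
    have hcomp := MonoidHom.ker_transferSylow_isComplement' V hV
    have hnd := MonoidHom.not_dvd_card_ker_transferSylow V hV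
    have hnorm : ((MonoidHom.transferSylow V hV).ker).Normal := inferInstance
    generalize (MonoidHom.transferSylow V hV).ker = M₀ at hcomp hnd hnorm
    by_cases hM : M₀ = ⊥
    · rw [hM, Subgroup.isComplement'_bot_left] at hcomp
      have : P = H := by
        rw [hPdef, hcomp, ← MonoidHom.range_eq_map, Subgroup.range_subtype]
      rw [← this]
      exact hpro
    · refine oddM h (M := M₀.map H.subtype) hq (Subgroup.map_subtype_le _) ?_ ?_ ?_
      · rwa [← Nat.card_congr (M₀.equivMapOfInjective H.subtype H.subtype_injective).toEquiv]
      · rw [Ne, Subgroup.map_eq_bot_iff_of_injective _ H.subtype_injective]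
        exact hM
      · rintro g hg m ⟨w, hw, rfl⟩
        exact ⟨⟨g, hg⟩ * w * ⟨g, hg⟩⁻¹, hnorm.conj_mem w hw _, by simp⟩

theorem not_pronormal_two {H : Subgroup G}
    (ha5 : ∀ z : G, z ^ 2 = 1 → z ≠ 1 →
      ∃ g, g * z * g⁻¹ ≠ z ∧ z * (g * z * g⁻¹) = (g * z * g⁻¹) * z)
    (h2 : Nat.card H = 2) : ¬ IsPronormal H := by
  intro hH
  obtain ⟨⟨z, hz⟩, hz1, hzu⟩ := (Nat.card_eq_two_iff' (1 : H)).1 h2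
  have hz1' : z ≠ 1 := fun h1 => hz1 (Subtype.ext h1)
  have hel : ∀ y ∈ H, y = 1 ∨ y = z := by
    intro y hy
    by_cases h1 : y = 1
    · exact Or.inl h1
    · right
      exact congrArg Subtype.val (hzu ⟨y, hy⟩ (fun h3 => h1 (congrArg Subtype.val h3)))
  have hzz : z ^ 2 = 1 := by
    have := pow_card_eq_one' (x := (⟨z, hz⟩ : H))
    rw [h2] at this
    simpa using congrArg Subtype.val this
  obtain ⟨g, hg1, hg2⟩ := ha5 z hzz hz1'
  obtain ⟨x, hx, hxe⟩ := hH g⁻¹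
  set w := g * z * g⁻¹ with hw
  have hK : H ⊔ H.conjugate g⁻¹ ≤ Subgroup.centralizer {w} := by
    refine sup_le ?_ ?_
    · intro y hy
      rw [Subgroup.mem_centralizer_singleton_iff]
      rcases hel y hy with rfl | rfl
      · simp
      · exact hg2
    · intro y hy
      rw [mem_conjugate] at hy
      rw [Subgroup.mem_centralizer_singleton_iff]
      rcases hel _ hy with h1 | h1
      · have : y = 1 := by
          rw [mul_inv_eq_one] at h1
          simpa using h1
        rw [this]; simp
      · have : y = w := by
          rw [hw, ← h1]; group
        rw [this]
  have hxw := Subgroup.mem_centralizer_singleton_iff.1 (hK hx)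
  have hwm : w ∈ H.conjugate g⁻¹ := by
    rw [mem_conjugate, hw]
    have : g⁻¹ * (g * z * g⁻¹) * g⁻¹⁻¹ = z := by group
    rw [this]
    exact hz
  rw [← hxe, mem_conjugate, hxw, mul_inv_cancel_right] at hwm
  rcases hel _ hwm with h1 | h1
  · apply hz1'
    rw [hw, mul_inv_eq_one] at h1
    simpa using h1
  · exact hg1 h1

end Abstract

end PslPro

open PslPro in
theorem PslPro.main (q : ℕ) (hq : q.Prime) (hmod : q % 8 = 3 ∨ q % 8 = 5)
    (F : Type*) [Field F] [Fintype F] (hF : Fintype.card F = q)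
    (H : Subgroup (Matrix.ProjectiveSpecialLinearGroup (Fin 2) F)) :
    ¬ IsPronormal H ↔ Nat.card H = 2 := by
  have := Fact.mk hq
  have hchar : CharP F q := charP_of_card_eq_prime hF
  have hq2 : q ≠ 2 := by rintro rfl; omega
  have hs2 : ¬ IsSquare (2 : F) := by
    rw [FiniteField.isSquare_two_iff, hF]
    omega
  have h2 : (2 : F) ≠ 0 := by
    intro h0
    exact hs2 (h0 ▸ IsSquare.zero)
  have htr : ∀ X : Matrix.SpecialLinearGroup (Fin 2) F,
      (X : Matrix.ProjectiveSpecialLinearGroup (Fin 2) F) ^ q ≠ 1 → tr X ^ 2 ≠ 4 :=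
    fun X hX ht => hX (pow_of_tr q ht)
  have hfin : Finite (Matrix.ProjectiveSpecialLinearGroup (Fin 2) F) :=
    Quotient.finite _
  have hyp : Hyp (Matrix.ProjectiveSpecialLinearGroup (Fin 2) F) q :=
    { pq := hq
      q2 := hq2
      a1 := a1 hs2
      a2 := by
        intro x hx hxq
        obtain ⟨X, rfl⟩ := QuotientGroup.mk_surjective x
        exact a2 h2 hx (htr X hxq)
      a3 := by
        intro x g hx hxq hmem
        obtain ⟨X, rfl⟩ := QuotientGroup.mk_surjective x
        obtain ⟨Y, rfl⟩ := QuotientGroup.mk_surjective g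
        have hc : (X : Matrix.ProjectiveSpecialLinearGroup (Fin 2) F) *
            ((Y * X * Y⁻¹ : Matrix.SpecialLinearGroup (Fin 2) F) :
              Matrix.ProjectiveSpecialLinearGroup (Fin 2) F) =
            ((Y * X * Y⁻¹ : Matrix.SpecialLinearGroup (Fin 2) F) :
              Matrix.ProjectiveSpecialLinearGroup (Fin 2) F) * X := by
          obtain ⟨k, hk⟩ := hmem
          have hk' : (X : Matrix.ProjectiveSpecialLinearGroup (Fin 2) F) ^ k =
            ((Y * X * Y⁻¹ : Matrix.SpecialLinearGroup (Fin 2) F) :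
              Matrix.ProjectiveSpecialLinearGroup (Fin 2) F) := hk
          rw [← hk']
          exact (Commute.self_zpow _ k)
        rcases a3 h2 X Y hx (htr X hxq) (comm_lift' h2 hx hc) with h | h
        · left
          rw [← QuotientGroup.mk_mul, h, QuotientGroup.mk_mul]
        · right
          intro t ht
          obtain ⟨T, rfl⟩ := QuotientGroup.mk_surjective t
          have := h T (comm_lift' h2 hx ht)
          rw [← QuotientGroup.mk_inv, ← QuotientGroup.mk_mul, ← QuotientGroup.mk_mul, this,
            QuotientGroup.mk_inv]
      a4 := a4 h2 }
  constructor
  · intro hnp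
    by_contra hc
    apply hnp
    by_cases hu : ∀ u ∈ H, u ^ q = 1 → u = 1
    · by_cases h4 : 4 ∣ Nat.card H
      · exact case_four hyp hu h4
      · exact case_not4 hyp hu h4 hc
    · push Not at hu
      obtain ⟨u, huH, huq, hu1⟩ := hu
      exact a6 q hF hq2 H u huH hu1 huq
  · intro hc
    obtain ⟨u, v, huv⟩ := CharP.sq_add_sq F q (-1)
    exact not_pronormal_two (fun z => a5 h2 (by simpa using huv) z) hc

theorem stmt2 (q : ℕ) (hq : q.Prime) (hmod : q % 8 = 3 ∨ q % 8 = 5) (hq17 : 17 < q)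
    (F : Type*) [Field F] [Fintype F] (hF : Fintype.card F = q)
    (H : Subgroup (Matrix.ProjectiveSpecialLinearGroup (Fin 2) F)) :
    ¬ IsPronormal H ↔ Nat.card H = 2 := by
  exact PslPro.main q hq hmod F hF H
end

section
/- Let G = PSL(2, F_7) be the projective special linear group of degree 2 over the field with 7 elements. Then a subgroup H of G fails to be pronormal in G if and only if H has order 2. In particular, every subgroup of G of order different from 2 is pronormal in G. -/
open Matrix

set_option maxRecDepth 100000

/-! ### Codes for two by two matrices over the field with seven elements -/

/-- The code of the matrix with entries `a b c d` (taken modulo seven). -/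
def psEnc (a b c d : ℕ) : ℕ := a % 7 * 343 + b % 7 * 49 + c % 7 * 7 + d % 7

/-- Product of codes. -/
def psMul (x y : ℕ) : ℕ :=
  psEnc (x / 343 * (y / 343) + x / 49 % 7 * (y / 7 % 7))
    (x / 343 * (y / 49 % 7) + x / 49 % 7 * (y % 7))
    (x / 7 % 7 * (y / 343) + x % 7 * (y / 7 % 7))
    (x / 7 % 7 * (y / 49 % 7) + x % 7 * (y % 7))

/-- Inverse (adjugate) of a code. -/
def psInv (x : ℕ) : ℕ := psEnc (x % 7) (6 * (x / 49 % 7)) (6 * (x / 7 % 7)) (x / 343)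

/-- Negative of a code. -/
def psNeg (x : ℕ) : ℕ :=
  psEnc (6 * (x / 343)) (6 * (x / 49 % 7)) (6 * (x / 7 % 7)) (6 * (x % 7))

/-- Equality of codes up to sign. -/
def psEq (x y : ℕ) : Bool := Nat.beq x y || Nat.beq x (psNeg y)

/-- The determinant of a code is one. -/
def psDet (x : ℕ) : Bool :=
  Nat.beq ((x / 343 * (x % 7) + 6 * (x / 49 % 7 * (x / 7 % 7))) % 7) 1

/-- The code is that of a scalar matrix. -/
def psScal (x : ℕ) : Bool :=
  Nat.beq (x / 49 % 7) 0 && Nat.beq (x / 7 % 7) 0 && Nat.beq (x / 343 % 7) (x % 7)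

/-- Normalized codes of elements of the projective special linear group. -/
def psOk (x : ℕ) : Bool := psDet x && Nat.ble x (psNeg x)

/-- All normalized codes. -/
def psElems : List ℕ := (List.range 2401).filter psOk

/-- The letter number `k` (counted from one) of the alphabet `l`. -/
def psLetter : List ℕ → ℕ → ℕ
  | [], _ => 344
  | a :: l, k => bif Nat.beq k 1 then a else psLetter l (k - 1)

/-- Apply `f` to `n` after evaluating `n` to a numeral. -/
def psForce {α : Type} (f : ℕ → α) : ℕ → α
  | 0 => f 0
  | k + 1 => f (k + 1)

theorem psForce_eq {α : Type} (f : ℕ → α) (n : ℕ) : psForce f n = f n := by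
  cases n <;> rfl

/-- Value of the word `w` (base five digits, terminated by zero) in the alphabet `l`. -/
def psWord (l : List ℕ) : ℕ → ℕ → ℕ → ℕ
  | 0, _, acc => acc
  | n + 1, w, acc =>
    bif Nat.beq (w % 5) 0 then acc else
      psForce (fun w' => psForce (psWord l n w') (psMul acc (psLetter l (w % 5)))) (w / 5)

/-- Value of a word of length at most twelve. -/
def psEval (l : List ℕ) (w : ℕ) : ℕ := psWord l 12 w 344

/-- The remainder of the input after the first word. -/
def psSkip : ℕ → ℕ → ℕ
  | 0, w => w
  | n + 1, w => bif Nat.beq (w % 5) 0 then w / 5 else psForce (psSkip n) (w / 5)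

/-- Check a predicate on pairs, for every element of the first list. -/
def psAll (p : ℕ → ℕ → Bool) : List ℕ → List ℕ → Bool
  | [], _ => true
  | _ :: _, [] => false
  | a :: l, c :: m => p a c && psAll p l m

theorem psAll_spec (p : ℕ → ℕ → Bool) : ∀ (l m : List ℕ), psAll p l m = true →
    ∀ a ∈ l, ∃ c, p a c = true
  | [], _, _, a, ha => by simp at ha
  | _ :: _, [], h, _, _ => by simp [psAll] at h
  | b :: l, c :: m, h, a, ha => by
    simp only [psAll, Bool.and_eq_true] at h
    rcases List.mem_cons.1 ha with rfl | ha
    · exact ⟨c, h.1⟩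
    · exact psAll_spec p l m h.2 a ha

/-- Codes of the two generators of the fifteen representative subgroups. -/
def psGens : List (ℕ × ℕ) :=
  [(344, 344), (91, 91), (92, 644), (91, 821), (91, 859), (91, 915), (91, 690), (93, 606), (91, 401), (91, 120), (91, 125), (92, 120), (409, 451), (425, 514), (93, 121)]

/-- Certificates for the classification of subgroups: one row for each representative. -/
def psUp : List (List ℕ) :=
  [[5113265, 29689282, 29689303, 25764035, 25757619, 95385553463, 25757106, 5114385, 29690466,
    29690439, 25769123, 25757123, 95385552807, 25758226, 5113713, 25757554, 95385552407,
    25758307, 25763187, 29689735, 29689778, 0, 95385565815, 95385570535, 29707495, 95385561063,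
    29702775, 29698023, 29689287, 25763875, 25757587, 95385553527, 25757202, 5113361, 29689266,
    29690471, 25757171, 25758258, 29690386, 25769043, 95385552791, 5114417, 95385552327,
    29689799, 25757618, 25763475, 5113777, 25758291, 29689730, 29689783, 25757602, 25763011,
    5113761, 25758323, 29689714, 95385552375, 95385552823, 5114465, 29690407, 25757187, 25758306,
    29690434, 25769203, 95385553511, 25757122, 5113281, 29689298, 29689319, 25764083, 25757651,
    29695346, 29694882, 29695202, 29695634, 29695170, 29695490, 29695026, 25757186, 25763715,
    5113345, 25757555, 29689362, 95385553479, 29689271, 25758290, 5114449, 29690418, 29690391,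
    25769747, 25757107, 95385552775, 29689794, 25762867, 95385552359, 5113729, 29689751,
    25758275, 25757570, 25757650, 29689762, 25762723, 95385552343, 5113809, 29689719, 25758227,
    29690402, 29690487, 25769395, 25757139, 95385552839, 25758274, 5114433, 29689314,
    95385553447, 29689335, 25757138, 25764243, 5113297, 25757571, 25763186, 25762722, 25763042,
    25763474, 25763010, 25763330, 25762866, 29689346, 25757170, 25757635, 29689367, 5113329,
    95385553431, 25763667, 29690450, 25757155, 5114481, 25769555, 25758322, 29690423,
    95385552759, 25757634, 95385552391, 25758259, 25763043, 29689815, 29689746, 5113793,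
    29689810, 5113745, 25757586, 95385552311, 25758243, 25763331, 29689767, 25758242, 29690455,
    95385552855, 29690482, 25757203, 5114401, 25769475, 25757154, 25757603, 29689351, 5113313,
    95385553495, 25763507, 29689330],
   [65536, 29689282, 29689303, 25764035, 25757619, 131611550, 25757106, 26281398, 4986249,
    29690439, 25769123, 25757123, 684931384, 4986250, 13174198, 4995385, 684918200, 25758307,
    25763187, 29689735, 4994490, 0, 684922248, 66600750, 29707495, 136067894, 29702775, 29698023,
    29689287, 4986248, 25757587, 66595854, 25757202, 13305368, 29689266, 29690471, 25757171,
    5001750, 5001754, 25769043, 136054198, 13174200, 136065878, 29689799, 4982202, 4993880,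
    13311830, 25758291, 29689730, 29689783, 25757602, 25763011, 13313174, 25758323, 4982201,
    131597854, 131612462, 13310104, 29690407, 25757187, 4999065, 4999062, 25769203, 684918200,
    25757122, 26281400, 29689298, 29689319, 25764083, 25757651, 4986246, 5001753, 29695202,
    29695634, 29695170, 29695490, 4999066, 4995897, 25763715, 13317910, 25757555, 29689362,
    136071062, 29689271, 25758290, 13310358, 4994486, 29690391, 25769747, 4982195, 136073750,
    29689794, 25762867, 684929880, 4982196, 29689751, 25758275, 25757570, 25757650, 29689762,
    25762723, 684929880, 4982197, 29689719, 25758227, 29690402, 29690487, 4994483, 25757139,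
    684922248, 4995382, 26417814, 4993882, 66599838, 29689335, 25757138, 25764243, 26293686,
    4982200, 4982198, 4993881, 25763042, 25763474, 25763010, 25763330, 4995898, 4994489, 4993878,
    25757635, 29689367, 26424280, 136066486, 25763667, 29690450, 25757155, 1837685, 25769555,
    25758322, 29690423, 136067382, 25757634, 131607566, 25758259, 25763043, 29689815, 29689746,
    26293080, 29689810, 26412952, 25757586, 684931384, 4995384, 25763331, 29689767, 25758242,
    29690455, 136058246, 29690482, 25757203, 1837604, 25769475, 4995386, 25757603, 29689351,
    13185880, 66586142, 25763507, 4995894],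
   [545785272, 65536, 29689303, 25764035, 25757619, 87368550, 127213819, 3475994, 4986251,
    29690439, 25769123, 25757123, 136126667, 8718921, 3482009, 25626122, 140315195, 25758307,
    25763187, 29689735, 1846059, 0, 681055624, 234829049, 29707495, 87700438, 29702775, 29698023,
    29689287, 25763875, 4983421, 87366859, 5054667, 107021852, 725950667, 29690471, 25757171,
    4991051, 9308745, 25769043, 557582296, 26282621, 46735606, 29689799, 9382699, 25763475,
    3482470, 25758291, 3488475, 29689783, 439950539, 25763011, 683417800, 25758323, 9315002,
    46729803, 234818121, 545790104, 29690407, 5053229, 29562251, 1837643, 25769203, 353109432,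
    131072, 722732488, 439951771, 29689319, 25764083, 25757651, 684922251, 28063739, 9046601,
    16910874, 3480779, 125641579, 144247421, 136124013, 25763715, 1847754, 25757555, 21501883,
    721956296, 29689271, 108344283, 132188764, 26413627, 29690391, 4996701, 25757107, 721952968,
    5064043, 5052013, 439951769, 683417640, 29689751, 25758275, 17578715, 17441177, 69024667,
    25762723, 87696230, 349177816, 29689719, 4994141, 17238554, 29690487, 25769395, 25757139,
    235145801, 9374283, 1837641, 25692731, 681051592, 29689335, 69017851, 25764243, 13175421,
    25757571, 108340075, 5065835, 9243209, 17500698, 25434651, 684918219, 136130173, 144258141,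
    144260701, 25757635, 29689367, 3486678, 132197019, 25763667, 684927051, 25757155, 21436013,
    25769555, 1848571, 29690423, 144246219, 28059115, 87372758, 25758259, 25763043, 29689815,
    4982219, 1843446, 25691625, 1843898, 29558219, 235156729, 25758243, 25763331, 29689767,
    17435162, 29690455, 439624089, 25106363, 25757203, 107612108, 25769475, 3482011, 25757603,
    29689351, 1848569, 46407926, 5058173, 136125229],
   [65536, 144250246, 29689303, 70529878, 149173078, 27932086, 709498246, 26281398, 4986249,
    29690439, 132266009, 25107373, 755369398, 4986250, 13174198, 4995385, 480118198, 66721945,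
    25120461, 29689735, 4994490, 0, 111490486, 21378486, 29707495, 136067894, 29702775, 29698023,
    29689287, 4986248, 66726921, 95094198, 26417821, 13305368, 144246198, 29690471, 132253177,
    5001750, 5001754, 149173686, 136054198, 13174200, 136065878, 27919798, 4982202, 4993880,
    13311830, 70531382, 144265753, 29689783, 26422061, 70530486, 13313174, 9374325, 4982201,
    140969398, 27932982, 13310104, 29690407, 149174582, 4999065, 4999062, 25635629, 150812982,
    709494198, 26281400, 66593708, 21366198, 25112605, 29558197, 4986246, 5001753, 144258486,
    144263065, 13310893, 107611595, 4999066, 4995897, 29558197, 13317910, 70518198, 26413597,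
    136071062, 29689271, 107623675, 13310358, 4994486, 29690391, 149174582, 131072, 136073750,
    66591980, 149161398, 355599798, 4982196, 29689751, 70530486, 131605420, 13315197, 13321309,
    70531382, 111495062, 4982197, 29689719, 149161398, 144259382, 29690487, 720896, 149173686,
    558761398, 4995382, 26417814, 4993882, 21383062, 29689335, 144258489, 70518198, 26293686,
    4982200, 4982198, 4993881, 107621723, 131603692, 26421629, 144263062, 4995898, 4994489,
    4993878, 25627165, 27923846, 26424280, 136066486, 149173078, 144265750, 25631389, 1837685,
    25635197, 144257878, 29690423, 136067382, 144259385, 108201398, 25101837, 9374325, 29689815,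
    144259894, 26293080, 13305357, 26412952, 709505878, 150812086, 4995384, 132264025, 21370246,
    107620331, 29690455, 136058246, 683292982, 66717209, 1837604, 132265481, 4995386, 70529878,
    29689351, 13185880, 68879798, 132259513, 4995894],
   [65536, 69022813, 29689303, 70529878, 149173078, 144321430, 108343453, 26281398, 5048201,
    29690439, 150873062, 17565125, 140117950, 4986250, 13174198, 4995385, 144318502, 111544198,
    29624197, 29689735, 4994490, 0, 144330342, 66600750, 29707495, 136067894, 29702775, 29698023,
    29689287, 4986248, 111551462, 66595854, 5067846, 27993062, 69012045, 29690471, 150865798,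
    5001750, 5001754, 150872102, 136054198, 5048197, 136065878, 29689799, 4982202, 5057432,
    13311830, 70531382, 131614060, 29689783, 5065830, 70530486, 13313174, 9374325, 4982201,
    144327606, 131612462, 21432198, 29690407, 149174582, 4999065, 4999062, 21366198, 144331846,
    108336749, 3474885, 66593708, 29689319, 27919798, 29558197, 4986246, 5055465, 108338237,
    66587260, 5054506, 107611596, 5057430, 5054505, 29558197, 13317910, 70518198, 5054502,
    136071062, 29689271, 69028445, 13310358, 4994486, 29690391, 149174582, 5066344, 136073750,
    66591980, 149161398, 107620174, 131072, 29689751, 70530486, 131605420, 5067850, 5066342,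
    70531382, 107612094, 4982197, 29689719, 149161398, 107617068, 29690487, 5054504, 150872102,
    144329830, 4995382, 26417814, 5063606, 144319462, 29689335, 66602348, 70518198, 27992102,
    4982200, 4982198, 4993881, 69020125, 131603692, 5066346, 107615740, 5048198, 5057433,
    4993878, 21370246, 29689367, 28050934, 136066486, 149173078, 108339613, 27923846, 1837685,
    17565125, 140117452, 29690423, 136067382, 131598972, 131607566, 29624197, 9374325, 29689815,
    140126188, 18220997, 5065834, 28057270, 140122924, 140126030, 5048200, 111544198, 29689767,
    107620332, 29690455, 136058246, 140121596, 150873062, 720896, 150865798, 5055462, 70529878,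
    29689351, 25299493, 144312198, 111551462, 4995894],
   [65536, 95237213, 29689303, 25705469, 25437677, 144331526, 95229437, 26281398, 4986249,
    29690439, 5054344, 25107373, 144329446, 5048282, 13174198, 4995385, 140125838, 5048280,
    25120461, 29689735, 4994490, 0, 144330054, 66600750, 29707495, 136067894, 29702775, 29698023,
    29689287, 4986248, 27919798, 144321990, 26417821, 13305368, 95226445, 29690471, 21366198,
    5001750, 5064042, 25698765, 136054198, 21432278, 136065878, 29689799, 4982202, 4993880,
    13311830, 70531382, 5066054, 29689783, 26422061, 25698717, 13313174, 25626520, 4982201,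
    131597854, 131612462, 13310104, 29690407, 150872998, 4999065, 4999062, 25635629, 144319398,
    141104749, 27991942, 5064038, 29689319, 25112605, 25101848, 4986246, 5057990, 28056637,
    5055401, 13310893, 141113517, 5054346, 5067526, 25630760, 27992998, 70518198, 26413597,
    136071062, 29689271, 28066189, 13310358, 4994486, 29690391, 150872998, 25692712, 136073750,
    5064041, 149161398, 144328038, 28057640, 29689751, 25691629, 5065446, 13315197, 13321309,
    70531382, 107619982, 131072, 29689719, 149161398, 141100989, 29690487, 25698344, 25429965,
    140132638, 4995382, 26417814, 5055402, 144312278, 29689335, 5055398, 70518198, 26293686,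
    4982200, 4982198, 5048278, 21506525, 5065449, 26421629, 95238877, 4995898, 5054342, 4993878,
    25627165, 29689367, 26424280, 136066486, 25706893, 28058013, 25631389, 720896, 25635197,
    28058061, 29690423, 136067382, 5066057, 144318342, 25101837, 25701384, 29689815, 28050925,
    21438342, 13305357, 26412952, 28062157, 107626782, 4995384, 5057992, 29689767, 95232877,
    29690455, 136058246, 21497805, 5066056, 28052008, 27923846, 5057994, 25700173, 29689351,
    28050918, 66586142, 21370246, 4995894],
   [65536, 25307945, 29689303, 142620985, 103290249, 21379385, 25041977, 458752, 4986249,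
    29690439, 26359835, 25107373, 27932985, 4986250, 720896, 4995385, 21370250, 142611849,
    16920187, 29689735, 4994490, 0, 131533337, 27939353, 29707495, 21385753, 29702775, 29698023,
    29689287, 4986248, 17572537, 66595854, 26417821, 13305368, 25037337, 29690471, 17584425,
    134428984, 5001754, 25044888, 755369400, 13174200, 27931482, 29689799, 4982202, 4993880,
    62463832, 27919800, 128910841, 29689783, 26422061, 25307944, 95225768, 25626520, 4982201,
    131597854, 21377882, 13310104, 29690407, 21366200, 4999065, 128911257, 25305496, 65997337,
    25305497, 26281400, 128911993, 29689319, 25041432, 25101848, 131072, 5001753, 25305721,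
    21377881, 25047065, 27931481, 4999066, 4995897, 25630760, 87302841, 349046200, 17244410,
    95094200, 29689271, 25045465, 84681401, 17506554, 29690391, 142611848, 1560806942, 65997336,
    27932089, 722601400, 13260171, 17448954, 29689751, 25298808, 17247865, 25317273, 25439802,
    103290248, 134419848, 17444473, 29689719, 545658248, 21378489, 29690487, 516949534, 25037336,
    17441467, 17507001, 27932984, 4993882, 95107897, 29689335, 25697513, 683283848, 21379384,
    4982200, 786432, 4993881, 3482299, 25045466, 3485307, 25317274, 4995898, 4994489, 109839800,
    5060605, 29689367, 3494185, 131533336, 27936665, 25044889, 5053645, 3485305, 27919802,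
    142607800, 29690423, 108201400, 5060635, 131607566, 21385754, 25111560, 29689815, 27923848,
    3481850, 25314393, 3482297, 103286200, 140969400, 4995384, 21383065, 29689767, 5068171,
    29690455, 748819848, 21370248, 27919801, 3489786, 17584425, 4995386, 21366201, 29689351,
    3491946, 66586142, 17572537, 139732888],
   [108349337, 140131227, 65536, 125644589, 142674478, 152519390, 70518238, 108338232, 21432878,
    4986254, 103286238, 17434542, 152452542, 148572027, 108332920, 107677563, 47057534, 16914254,
    109843854, 1846062, 17244414, 0, 152446446, 659825516, 4990446, 88030414, 3488974, 19867630,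
    17572094, 125647677, 46664318, 558107260, 148507227, 108343897, 13174238, 3481854, 125635192,
    87375054, 128911227, 27923854, 47071022, 108341225, 88023294, 29624878, 131608667, 86057214,
    108339032, 9055022, 128648699, 4982238, 140123339, 125643560, 108201438, 109906478,
    136185723, 659831804, 558111260, 108338696, 131072, 125652680, 131603227, 43780734,
    109839838, 152438238, 108337965, 108336632, 140133739, 19858926, 125639192, 125646877,
    131612843, 26281438, 136120878, 27986478, 108345661, 148511531, 140127131, 140124619,
    125638808, 144246238, 86312878, 128846427, 558112412, 1851182, 140446299, 108348009,
    26295742, 17565614, 125648477, 142611854, 558115628, 108348861, 13240878, 152510878,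
    95094238, 5063390, 125646077, 147981819, 21438878, 108349181, 45353598, 720896, 68879838,
    17569614, 87623598, 149165454, 1837694, 9046654, 142607838, 152504878, 8718974, 44763774,
    13182446, 4063232, 4996542, 108336861, 26354078, 108345337, 125640344, 17500078, 149161438,
    9243262, 131598267, 140117515, 128850731, 108345981, 108333661, 132253179, 125645389,
    3479374, 140969438, 88016814, 16916734, 150932059, 21370254, 108340632, 103352878, 131611115,
    25364446, 88020814, 140135019, 152442254, 27919838, 17438542, 786432, 131616667, 136120878,
    131606155, 108339897, 17237934, 659819116, 16910254, 86050734, 3475374, 26285454, 5054878,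
    3997696, 17504078, 9308798, 108337432, 125643789, 87361454, 125633992, 5048878, 108332521,
    47065902, 21366238, 149292539],
   [65536, 95226493, 125583150, 27919802, 21385754, 131611550, 134552349, 109856666, 4986249,
    333074427, 132266009, 25107373, 27933498, 4986250, 109851482, 4995385, 549921709, 66721945,
    16923453, 21379386, 4994490, 0, 140315213, 66600750, 27932986, 95113754, 150812986,
    333062395, 107026029, 131072, 66726921, 111495066, 25050105, 108332570, 134548045, 107612110,
    132253177, 139991849, 5001754, 128264669, 352716233, 720896, 21379898, 150811482, 4982202,
    5048284, 17444413, 27939354, 107629291, 134415802, 25312857, 128521949, 16920125, 106960377,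
    4982201, 131597854, 111491898, 69017098, 140445662, 21366202, 4999065, 25303850, 25635629,
    713230925, 107618555, 458752, 66593708, 125578254, 25112605, 111478201, 126894074, 5001753,
    62463037, 66587260, 25370666, 25309033, 4999066, 4995897, 111478201, 17509949, 128256589,
    25048665, 95094202, 67387182, 95232941, 17247805, 126884122, 66000377, 144257881, 5064204,
    746205033, 107617515, 126686829, 131805033, 786432, 21377882, 126694653, 144263066, 25036234,
    25313673, 144258489, 27936666, 21366201, 107028893, 128529501, 25040377, 134435354, 3474924,
    125377597, 107029421, 3490077, 109853498, 4993882, 66599838, 148577982, 144257882, 125382813,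
    109852986, 2359296, 106956233, 4993881, 134556125, 144259386, 3488573, 25303849, 4995898,
    4994489, 3485245, 25627165, 67372574, 142621498, 150813498, 144259385, 107630587, 25631389,
    27933497, 25635197, 25307113, 111489882, 21383066, 144259898, 131607566, 25101837, 150813497,
    131802601, 25036233, 21383065, 3491741, 142619482, 25049577, 65996233, 3484316, 132264025,
    67382286, 25053449, 111491386, 150816666, 25306601, 66717209, 3997696, 132265481, 4995386,
    144250249, 27931482, 27919801, 66586142, 132259513, 25371626],
   [65536, 3478923, 109856666, 134419850, 25048941, 111478202, 25692762, 59191322, 131072,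
    58466138, 86251930, 25107373, 134428090, 4986250, 3490906, 3735552, 142620986, 25310381,
    25120461, 103303066, 4994490, 0, 16913803, 136127709, 111482250, 136120939, 142752574,
    21370250, 87300506, 108333020, 95160939, 144257882, 25041835, 11684154, 87955866, 150803850,
    5048221, 17237899, 5001754, 25313021, 21366202, 107546588, 103305754, 84416922, 4982202,
    25692124, 11673434, 17570202, 3475339, 27923850, 5066443, 95107898, 18228378, 16929066,
    2359296, 91238986, 140318094, 18228794, 13247709, 103290250, 786432, 17439130, 26365643,
    17438091, 21379386, 333055468, 21432939, 21511934, 25112605, 91170362, 17450074, 458752,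
    21378490, 60825243, 13310893, 25436570, 4999066, 2424832, 140318762, 93586954, 5055709,
    26413597, 26353869, 144246202, 18232763, 3479962, 91173450, 25434158, 27939354, 25697660,
    150813498, 18230171, 21383066, 27933498, 20119552, 17442443, 25056509, 17565579, 13315197,
    25298443, 5054669, 66393706, 140122908, 21377882, 142621498, 18221611, 27931482, 108332524,
    21385754, 90650043, 16914842, 11681738, 4993882, 87573594, 142624666, 13240221, 17581146,
    18231882, 25698764, 16925786, 3997696, 11686427, 11674603, 17500043, 11677243, 4995898,
    720896, 29624939, 13258443, 150811482, 3494186, 21379898, 27936666, 95105882, 25631389,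
    3361212380, 25635197, 134415802, 26354909, 13246669, 17242522, 109859354, 25101837, 17453354,
    16918155, 27932986, 107615964, 13305357, 21438669, 3483275, 27919802, 142744956, 85727642,
    67382286, 27932090, 131809021, 95111066, 69012091, 25042445, 18808832, 17584426, 4995386,
    25299549, 87576874, 330434524, 141053643, 16910219, 5048939],
   [65536, 95229323, 99161819, 125380588, 494343899, 131611550, 25041979, 90643835, 17443387,
    142740046, 16930043, 25107373, 497161947, 131072, 66394907, 99485563, 26363643, 57880363,
    25120461, 13251019, 3735552, 0, 131861019, 84432123, 125641950, 746261019, 28064478,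
    66001979, 25692750, 111559389, 99362011, 66595854, 21503883, 26362589, 25365019, 125582238,
    128325004, 100151627, 786432, 541461019, 352994587, 141046219, 87566907, 87574635, 2359296,
    704977979, 98834139, 84756587, 99493083, 66389452, 26422061, 84428907, 99358427, 5065581,
    19859323, 131597854, 131612462, 27993069, 99157883, 136136443, 90644315, 25692059, 13252187,
    66325019, 25305499, 676804187, 93586907, 140053019, 25112605, 25372221, 18226555, 99354491,
    126890139, 3495163, 13310893, 28057099, 458752, 18227035, 5063389, 17451115, 128590700,
    5060187, 70600443, 91233659, 5064443, 16926827, 60820027, 26358219, 87902315, 25364365,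
    91234139, 18234571, 140117438, 90971995, 21447389, 87304763, 28056492, 19866843, 25049259,
    25379211, 84756587, 131810587, 20119552, 90971515, 91241675, 127207339, 455023995, 5055469,
    140126491, 13256443, 3491947, 107225499, 2424832, 66599838, 21501550, 100158059, 28051404,
    304155195, 106976475, 11685947, 11674779, 125246107, 25696411, 25316331, 5059019, 3997696,
    3484219, 99489499, 26359387, 67372574, 13257581, 494019803, 126682572, 21513035, 25631389,
    18808832, 25635197, 25056475, 127014510, 149243643, 91307211, 140318206, 25101837, 25302861,
    99420027, 25314587, 140126492, 13305357, 21439469, 17508923, 66274587, 62408443, 17454331,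
    128517646, 125315451, 107285019, 698750571, 126617531, 58404651, 108282589, 98837723, 720896,
    58216507, 107616539, 139993499, 58208043, 107236331, 19863259],
   [134430301, 65536, 25037438, 150865821, 131794462, 26347421, 330107501, 345835421, 131072,
    11673486, 149234909, 124984237, 134417021, 95160221, 95106141, 95166669, 12189696, 125240861,
    26353869, 106894957, 140318318, 0, 27934301, 333383164, 25307038, 67307421, 11681070,
    58539310, 25312862, 142739420, 4983421, 10616832, 108343325, 26354909, 709495421, 58525630,
    5048221, 3735552, 142622301, 13246669, 705317485, 26282621, 132843421, 25298462, 550635421,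
    25692124, 292429710, 25381485, 2359296, 11667390, 136120221, 132909660, 27985821, 149173341,
    542449869, 68881021, 58466190, 313067421, 28052014, 24976173, 786432, 109854301, 13305372,
    62392221, 393216, 140981341, 722667421, 26412526, 106901117, 125307501, 657720861, 339217021,
    705365501, 108273869, 2097152, 66586526, 150811741, 132849869, 109841021, 90966622, 5055709,
    139664173, 68945821, 26420446, 21367421, 131609564, 61014016, 25434158, 4996701, 25697660,
    134481821, 289218446, 24974957, 70584221, 91163230, 18230174, 13310892, 94109696, 111490141,
    714475421, 5054669, 54200221, 140122908, 11927552, 4994141, 141035421, 458752, 127011388,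
    70519421, 111492701, 139795981, 21432221, 2424832, 103298141, 18235342, 333393469, 25379325,
    13175421, 25698764, 106957438, 517941325, 108267421, 558833869, 3997696, 660741500, 27931741,
    131934285, 69021245, 125635101, 720896, 2708739804, 109851741, 632948172, 111479421,
    128194604, 26293341, 69010940, 150801021, 25042990, 20054016, 666897021, 21380701, 149162621,
    126555981, 131867325, 10551296, 107615964, 21378141, 21438669, 18808832, 149227421,
    142744956, 549325438, 25051646, 755435421, 18221662, 660742604, 27921021, 149234909,
    13247709, 25371325, 3670016, 108336972, 128584238, 108213341, 13240221, 24981117, 54206669],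
   [61341696, 1837693, 87295901, 9320797, 16926141, 45295005, 3480349, 3997696, 3475357,
    43453053, 642655149, 86383389, 87890717, 132916205, 3670016, 1848285, 86247325, 626656797,
    46926461, 84412317, 106962125, 0, 87558045, 9315741, 87301357, 439814045, 45288061, 84417773,
    87563501, 25313565, 65536, 9053597, 714544525, 2148992925, 17570589, 16915693, 131072,
    504832637, 54265741, 17450429, 106969085, 9243261, 43459997, 17439981, 142748573, 421595037,
    9250205, 128189901, 12255232, 111609790, 706359885, 9058653, 17500061, 59375616, 9384925,
    17439517, 86252317, 140321470, 131538125, 127016317, 17565597, 11862016, 87956717, 46343581,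
    9374333, 17242909, 10289152, 9046653, 43787677, 128584301, 458752, 140127694, 47002589,
    1849693, 667040061, 3480813, 132914845, 667031597, 84608925, 2424832, 84084637, 87366429,
    66266269, 9308797, 84739997, 2097152, 107620638, 44763773, 128591853, 125044621, 85728029,
    3491261, 46674909, 87563037, 45353597, 84674461, 86378397, 18415616, 675228797, 46729853,
    87230365, 84744989, 2359296, 125699518, 127010269, 1844637, 140003805, 128197613, 43780733,
    436930461, 720896, 17237917, 142740077, 16915229, 46598781, 20381696, 128205309, 8718973,
    436537245, 10551296, 131598302, 9319389, 9386333, 46736797, 17571053, 54274333, 504826461,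
    267261885, 25049085, 43715197, 786432, 422255389, 46933405, 16910237, 25042125, 20054016,
    25306269, 17434525, 148506062, 431949725, 17581501, 85723037, 25315805, 51511296, 128648686,
    45429725, 8725917, 87366893, 393216, 9057245, 430311325, 25056333, 641079341, 84679917,
    9381277, 128321486, 431622045, 87885725, 632948701, 84614381, 4063232, 142743837, 87951261,
    140314110, 17505517, 43722141, 2031616, 131611454],
   [2359296, 2381122078, 552338910, 84186382622, 700779102, 3814599230, 66599646, 2097152,
    44247812046, 742917662, 131598286, 43225122270, 7829471182, 536939086, 20119552,
    323818685918, 3567657374, 3363054510, 1724130222, 125051758, 3297314686, 0, 3321891422,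
    11925465070, 25109918, 13031389822, 701957582, 111618430, 132908494, 85633731118, 713557534,
    3814589886, 65536, 2378438142, 1765607390, 635176846, 1696902743518, 3997696, 557910606,
    660669902, 2586184270, 3525328174, 19066587022, 636487198, 18658887550, 131072, 2770020430,
    1724785054, 331810734, 140453278, 59703296, 33401538494, 68225730062, 1766722142, 6786647534,
    19074713470, 762382926, 536814750, 128917758, 3405645342, 1681524686, 467078809470, 458752,
    3733064254, 476194446, 2708735502, 3528591278, 636750398, 11862016, 1681530926, 2424832,
    312353230, 1356990414, 94640022446, 721749502, 2585920990, 3526378206, 131611950,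
    93415541310, 2597928542, 660677790, 393216, 13604160958, 140446270, 68226975646, 536283054,
    10616832, 748947998, 131612958, 33396295198, 2586192350, 140131726, 38524159966, 12618506494,
    100663296, 25626062, 39349913566, 3364161502, 3405646398, 3735552, 538190702, 19068159918,
    8410761118, 25633950, 84185384878, 1562248686, 635176894, 68021847518, 95464195534,
    331811390, 17655924654, 3670016, 39556351966, 19075106286, 345246238, 140125102, 85627110910,
    18808832, 330368462, 20054016, 2706180638, 93415540254, 3567920046, 538249182, 658120958,
    83372737982, 3732807566, 657859262, 720896, 308217374, 64124488270, 3567651406, 1356996654,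
    16836728206, 10551296, 658115102, 7909607294, 107621502, 743245262, 19076680286, 3610518750,
    95292102030, 94427036974, 66593406, 108342622, 2750033022, 18743296, 131604526, 699015422,
    42416014782, 95326439390, 4063232, 700785342, 127206926, 107611662, 128911310, 3567659486,
    3774088670, 3405654686, 786432, 12826183198, 1561855966, 17903912478, 107612798, 11927552,
    333776782, 19134088702, 1726285790],
   [2345271296, 1329463296, 65536, 18808832, 2557935616, 462815232, 1534001152, 2353463296,
    2345336832, 131072, 10551296, 2549743616, 257949696, 1525809152, 10616832, 11562909696,
    18743296, 1533935616, 7679901696, 462749696, 258015232, 0, 501743616, 2353201152, 297336832,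
    510001152, 6410141696, 305463296, 265879552, 52887552, 10289152, 7466582016, 2517041152,
    61407232, 1280311296, 469041152, 264503296, 2314141696, 1485176832, 460783616, 256376832,
    1493303296, 1526071296, 786432, 12789743616, 12255232, 6614614016, 92471296, 2305949696,
    6400311296, 3997696, 94109696, 51249152, 2304049152, 7637041152, 266207232, 511574016,
    20054016, 393216, 59768832, 101974016, 3670016, 469368832, 305135616, 100335616, 6647382016,
    1527382016, 503382016, 1535901696, 511901696, 6410207232, 1280049152, 2359296, 2510487552,
    53149696, 501809152, 1322909696, 1494614016, 298582016, 59375616, 11766071296, 7432568832,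
    4063232, 502071296, 2312568832, 102301696, 1484783616, 470614016, 93782016, 18415616,
    6613303296, 3735552, 461111296, 458752, 51511296, 7669743616, 20119552, 2509111296,
    306774016, 61014016, 11862016, 2031616, 1493368832, 264568832, 20381696, 1535967232,
    305201152, 296943616, 503447552, 511967232, 100401152, 92143616, 92536832, 255983616,
    7423983616, 6614679552, 1290141696, 1322647552, 100663296, 509935616, 2559901696, 297271296,
    53215232, 2424832, 7425949696, 11767382016, 51576832, 461176832, 59703296, 469303296,
    2517303296, 1486749696, 1282015232, 12585271296, 256049152, 12189696, 1290207232, 7424049152,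
    298909696, 720896, 470679552, 102367232, 12586582016, 93847552, 10223616, 61341696, 18481152,
    11520311296, 1486487552, 92209152, 2313879552, 297009152, 7433879552, 462487552, 2303983616,
    298647552, 51183616, 266141696, 59441152, 1494679552, 307167232, 2097152, 61079552, 20447232,
    2346582016, 11927552, 256311296, 7629111296]]

/-- Certificates for pronormality: one row for each representative. -/
def psPro : List (List ℕ) :=
  [[0, 0, 0, 0, 0, 0, 0, 0, 0, 0, 0, 0, 0, 0, 0, 0, 0, 0, 0, 0, 0, 0, 0, 0, 0, 0, 0, 0, 0, 0, 0,
    0, 0, 0, 0, 0, 0, 0, 0, 0, 0, 0, 0, 0, 0, 0, 0, 0, 0, 0, 0, 0, 0, 0, 0, 0, 0, 0, 0, 0, 0, 0,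
    0, 0, 0, 0, 0, 0, 0, 0, 0, 0, 0, 0, 0, 0, 0, 0, 0, 0, 0, 0, 0, 0, 0, 0, 0, 0, 0, 0, 0, 0, 0,
    0, 0, 0, 0, 0, 0, 0, 0, 0, 0, 0, 0, 0, 0, 0, 0, 0, 0, 0, 0, 0, 0, 0, 0, 0, 0, 0, 0, 0, 0, 0,
    0, 0, 0, 0, 0, 0, 0, 0, 0, 0, 0, 0, 0, 0, 0, 0, 0, 0, 0, 0, 0, 0, 0, 0, 0, 0, 0, 0, 0, 0, 0,
    0, 0, 0, 0, 0, 0, 0, 0, 0, 0, 0, 0, 0],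
   [],
   [3989583, 255, 3989583, 3389, 3989733, 3989733, 3383, 6383, 6384, 3389, 3990213, 3383, 6388,
    6383, 6383, 6383, 6384, 3383, 3990213, 3389, 6388, 255, 3989583, 3389, 3989733, 3989733,
    3383, 3989583, 3989583, 3383, 3388, 6384, 6388, 3388, 3389, 3383, 3989733, 6384, 6383,
    3990213, 3989583, 3388, 3989733, 3989733, 6388, 3990213, 135, 3990213, 6384, 3989733, 3389,
    3388, 3989583, 3990213, 6383, 6388, 3389, 3989583, 3383, 3388, 6384, 6388, 3388, 3989583,
    255, 3989583, 3389, 3989733, 3989733, 3383, 3383, 6388, 6383, 6383, 6384, 3389, 3990213,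
    3990213, 3389, 6383, 3388, 6388, 3989583, 3989733, 3389, 3388, 6384, 6388, 3388, 3383,
    3989583, 6388, 3388, 3383, 3989583, 3389, 3388, 6384, 6383, 3383, 3990213, 3989733, 3989583,
    6384, 3388, 6383, 6384, 3389, 3990213, 3383, 6388, 6383, 6384, 3989583, 6388, 3383, 3388,
    3388, 3389, 3389, 6388, 6383, 6383, 6384, 3383, 3990213, 3990213, 3990213, 3989733, 6384,
    135, 6388, 3989733, 3383, 3388, 3388, 3389, 6388, 3989583, 6384, 6388, 3989733, 3990213,
    3990213, 3989733, 6384, 135, 6383, 6383, 6384, 3383, 3990213, 3389, 6388, 6383, 3989583,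
    3389, 6388, 3990213, 3388, 3989733, 6384, 3383, 3989583, 6383, 3989733, 3388, 3990213],
   [255, 159613, 6383, 159613, 159613, 6383, 159613, 6383, 6389, 159613, 34508, 34508, 159613,
    6389, 6383, 6389, 159613, 34508, 34508, 159613, 6389, 255, 159613, 6383, 159613, 159613,
    6383, 159613, 159613, 6389, 34508, 6383, 34508, 6389, 159613, 6383, 34508, 6383, 6389,
    159613, 159613, 6389, 159613, 6383, 6389, 6389, 6383, 159613, 34508, 159613, 34508, 159613,
    6383, 6389, 6389, 6383, 6383, 6389, 159613, 159613, 6389, 6383, 34508, 159613, 159613, 6389,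
    34508, 6383, 34508, 6389, 6383, 6389, 159613, 34508, 34508, 159613, 6389, 6389, 6389, 6383,
    159613, 34508, 159613, 6383, 159613, 6383, 6383, 159613, 159613, 255, 159613, 34508, 159613,
    159613, 1380, 159613, 159613, 34508, 34508, 34508, 159613, 159613, 1380, 159613, 159613,
    159613, 159613, 255, 159613, 159613, 6383, 6383, 6389, 6383, 159613, 34508, 159613, 6383,
    6389, 6383, 6389, 159613, 34508, 34508, 159613, 6389, 6389, 6383, 34508, 6383, 6389, 159613,
    159613, 159613, 34508, 1380, 34508, 159613, 159613, 159613, 34508, 6383, 34508, 6389, 159613,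
    159613, 6389, 34508, 6389, 159613, 159613, 6389, 34508, 6383, 159613, 159613, 159613, 159613,
    34508, 1380, 34508, 6389, 159613, 159613, 6389, 6383, 34508, 6383],
   [255, 3388, 34508, 17013, 34634, 34508, 3384, 6383, 1385, 3384, 34508, 6383, 17013, 6389,
    6383, 680, 3388, 34508, 6383, 34634, 6389, 255, 3388, 34508, 17013, 34634, 34508, 3384, 3384,
    1305, 34508, 34508, 6383, 6389, 3388, 34508, 34508, 6383, 6389, 3388, 3384, 1305, 34634,
    34508, 6389, 135, 6383, 17013, 34508, 17013, 6383, 3384, 6383, 6389, 1385, 34508, 34508,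
    6389, 3388, 34634, 680, 6383, 6383, 3388, 3384, 1305, 34508, 34508, 6383, 6389, 6383, 1385,
    3384, 34508, 6383, 17013, 6389, 680, 6389, 6383, 3388, 6383, 34634, 34508, 3388, 6383, 6383,
    34634, 17013, 1380, 3384, 34508, 3384, 17013, 255, 34634, 3388, 34508, 6383, 6383, 34634,
    17013, 1380, 3384, 3388, 34634, 17013, 1380, 3384, 3388, 6383, 6383, 6389, 34508, 3388,
    34508, 3384, 6383, 1305, 6383, 680, 3388, 34508, 6383, 34634, 6389, 1385, 6383, 6383, 34508,
    6389, 3384, 17013, 3384, 6383, 1380, 6383, 17013, 3388, 34634, 34508, 34508, 6383, 6389,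
    34634, 17013, 135, 6383, 6389, 34634, 17013, 135, 34508, 34508, 17013, 3388, 3384, 34634,
    34508, 255, 34508, 6389, 34634, 17013, 135, 34508, 34508, 6383],
   [255, 3384, 34508, 34634, 17013, 34508, 3388, 6383, 6389, 17013, 6383, 34508, 3384, 1385,
    6383, 6389, 34634, 6383, 34508, 3388, 680, 255, 3384, 34508, 34634, 17013, 34508, 3388, 3388,
    6389, 6383, 34508, 34508, 1305, 3384, 34508, 6383, 6383, 680, 34634, 3388, 6389, 17013,
    34508, 1385, 6389, 6383, 3384, 6383, 34634, 34508, 17013, 6383, 135, 6389, 34508, 34508,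
    1305, 3384, 3388, 6389, 6383, 34508, 3384, 3388, 6389, 6383, 34508, 34508, 1305, 6383, 6389,
    17013, 6383, 34508, 3384, 1385, 6389, 1305, 6383, 3384, 34508, 3388, 34508, 34634, 6383,
    6383, 3388, 3384, 1380, 17013, 6383, 3388, 3384, 1380, 17013, 34634, 6383, 34508, 34508,
    3388, 34634, 255, 17013, 3384, 3388, 3384, 1380, 17013, 34634, 6383, 6383, 680, 34508, 34634,
    6383, 3388, 6383, 6389, 6383, 6389, 34634, 6383, 34508, 3388, 680, 6389, 6383, 34508, 34508,
    135, 17013, 34634, 17013, 34508, 255, 34508, 34634, 3384, 3388, 6383, 34508, 34508, 135,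
    17013, 34634, 6389, 34508, 135, 17013, 34634, 6389, 6383, 34508, 3384, 34634, 3388, 17013,
    6383, 1380, 6383, 1385, 17013, 3384, 6389, 34508, 6383, 6383],
   [1505, 37639, 37639, 37639, 37639, 37639, 37639, 7555, 188889, 188889, 188889, 188889, 188889,
    188889, 7535, 188389, 188389, 188389, 188389, 188389, 188389, 255, 31939, 31939, 31939,
    31939, 31939, 31939, 31949, 815959, 31924, 20399089, 32139, 4722069, 803459, 31949, 31938,
    6383, 4722199, 163173, 3992838, 4709673, 31949, 20399609, 4709699, 32638, 37633, 163163,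
    32139, 31949, 32139, 163163, 37633, 32638, 4709699, 20399609, 31949, 4709673, 3992838,
    163173, 4722199, 6383, 31938, 31949, 803459, 4722069, 32139, 20399089, 31924, 815959, 1305,
    163189, 163189, 163189, 163189, 163189, 163189, 163199, 815988, 37633, 20399088, 6389,
    944423, 940949, 163199, 37633, 6383, 798709, 160683, 502176789, 941913, 163199, 23524088,
    798539, 160684, 159709, 160669, 6389, 163199, 6389, 160669, 159709, 160684, 798539, 23524088,
    163199, 941913, 502176789, 160683, 798709, 6383, 37633, 163199, 940949, 944423, 6389,
    20399088, 37633, 815988, 1285, 160689, 160689, 160689, 160689, 160689, 160689, 160699, 6383,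
    6388, 20083984, 32639, 944433, 940949, 160699, 6384, 32639, 798613, 159569, 3993359, 941919,
    160699, 20086588, 798059, 31948, 940823, 159673, 32639, 160699, 32639, 159673, 940823, 31948,
    798059, 20086588, 160699, 941919, 3993359, 159569, 798613, 32639, 6384, 160699, 940949,
    944433, 32639, 20083984, 6388, 6383],
   [17138, 6383, 255, 6383, 17138, 6389, 6389, 6383, 17138, 6389, 6389, 17138, 6383, 685, 6383,
    1510, 6383, 17138, 6389, 6389, 17138, 255, 6383, 17138, 6389, 6389, 17138, 6383, 6383, 6383,
    6389, 17138, 685, 17138, 6389, 17138, 6383, 6389, 1510, 6389, 6383, 17138, 6389, 6383, 17138,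
    17138, 6383, 6389, 1510, 6389, 6383, 6383, 6389, 17138, 685, 17138, 17138, 6383, 255, 6383,
    17138, 6389, 6389, 6383, 6383, 6383, 6383, 6383, 6383, 6383, 17138, 6389, 6389, 17138, 6383,
    685, 6383, 6383, 6383, 6389, 17138, 1510, 17138, 6389, 1510, 17138, 6389, 6383, 6383, 6389,
    17138, 6383, 17138, 6389, 6389, 17138, 6383, 685, 17138, 6383, 6389, 255, 6389, 6383, 17138,
    6389, 6389, 6389, 6389, 6389, 6389, 6389, 6389, 255, 6389, 6383, 17138, 17138, 6383, 17138,
    6389, 6389, 17138, 6383, 1510, 6383, 6383, 1510, 6383, 17138, 6389, 6389, 17138, 685, 6389,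
    6383, 17138, 17138, 6383, 6389, 6383, 6383, 6389, 17138, 255, 17138, 6389, 17138, 17138,
    17138, 17138, 17138, 17138, 17138, 6389, 17138, 255, 17138, 6389, 6383, 6383, 6389, 6383,
    17138, 17138, 6383, 6389, 685],
   [1276, 159714, 798047, 159673, 159569, 798567, 159734, 31916, 6389, 159609, 3989742, 31916,
    798346, 798496, 31916, 6389, 159713, 3989292, 31916, 798346, 798496, 255, 19959047, 798672,
    797866, 798346, 798684, 159609, 19965347, 1277, 3989742, 798363, 31916, 159699, 3993322,
    798572, 3989292, 6383, 798496, 159713, 3993572, 6386, 797866, 798684, 798496, 31947, 31916,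
    159673, 798672, 798346, 31916, 159609, 31916, 798496, 6389, 3989742, 798363, 159699, 3993322,
    159569, 6389, 6383, 6383, 159713, 3993572, 6386, 798572, 3989292, 6383, 798496, 6383, 6389,
    159734, 798572, 6383, 159614, 159699, 6389, 798496, 31916, 159713, 31916, 798346, 3989292,
    159714, 31916, 6383, 797866, 159614, 31947, 3993572, 798672, 159609, 797866, 255, 798346,
    19959047, 798684, 6383, 31916, 159738, 798346, 31947, 19965347, 19959047, 159738, 798346,
    31947, 19965347, 19959047, 6383, 31916, 159699, 3989742, 3993322, 798363, 19965347, 31916,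
    1277, 6383, 6389, 3993322, 798363, 6383, 159569, 159699, 6389, 6383, 6383, 798572, 159699,
    159734, 159614, 3993572, 6383, 31947, 31916, 159614, 159714, 797866, 798684, 798672, 31916,
    798496, 797866, 159673, 31947, 6383, 159699, 159738, 797866, 31947, 798567, 798047, 159673,
    159714, 159734, 159569, 798047, 1276, 798567, 159699, 159738, 797866, 31947, 798567, 798047,
    6383],
   [1276, 550298, 190758, 110114, 37639, 31949, 6389, 31916, 1277, 550373, 37633, 22008, 862823,
    188197, 31916, 6389, 31939, 37633, 22008, 550198, 798737, 255, 862698, 115758, 953809,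
    159571, 190758, 37639, 550199, 38152, 178258, 31939, 22008, 2894072, 159737, 190758, 178258,
    6383, 550347, 37639, 31949, 23152, 797823, 115758, 159747, 35654, 31916, 188189, 37633,
    110039, 22008, 172572, 31916, 2894047, 4402, 190758, 115758, 4769309, 940823, 31948, 6387,
    6383, 34508, 953809, 159697, 7527, 37633, 115758, 34508, 798696, 6383, 6902, 159747, 178258,
    34508, 6389, 550297, 6389, 862862, 31916, 188199, 22008, 940823, 31949, 22014, 31916, 6383,
    953819, 172573, 7630, 578814, 178258, 110039, 37639, 1380, 31949, 798613, 37633, 34508,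
    22008, 188189, 862847, 7130, 31939, 31914, 940998, 31939, 4630, 110069, 862684, 6383, 31916,
    159697, 115758, 797873, 37633, 188199, 31916, 35652, 6383, 6389, 550363, 31946, 34508,
    159737, 188239, 4404, 6383, 34508, 31939, 31947, 188197, 172559, 159569, 34508, 1505, 22008,
    159673, 31949, 31939, 6389, 190758, 22008, 2894319, 862823, 159697, 23154, 34508, 940997,
    862739, 31949, 38154, 37633, 115758, 159747, 159741, 172559, 34514, 37633, 880, 178258,
    798487, 798548, 110069, 7529, 190758, 178258, 6383],
   [1276, 6389, 31949, 37639, 110114, 190758, 550298, 31916, 188197, 862823, 22008, 37633,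
    550373, 1277, 31916, 798737, 550198, 22008, 37633, 31939, 6389, 255, 37639, 190758, 159571,
    953809, 115758, 862698, 953809, 798696, 34508, 115758, 37633, 7527, 159697, 115758, 34508,
    6383, 6387, 31948, 940823, 4769309, 110039, 190758, 4402, 2894047, 31916, 172572, 22008,
    797823, 37633, 188189, 31916, 35654, 159747, 115758, 190758, 23152, 31949, 37639, 550347,
    6383, 178258, 550199, 159737, 2894072, 22008, 31939, 178258, 38152, 6383, 550297, 6389,
    34508, 178258, 159747, 6902, 159697, 35652, 31916, 188199, 37633, 797873, 115758, 940998,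
    31916, 6383, 862684, 110069, 4630, 31939, 34508, 31914, 31939, 7130, 862847, 188189, 22008,
    178258, 37633, 798613, 31949, 1380, 37639, 110039, 22014, 578814, 7630, 172573, 953819, 6383,
    31916, 6389, 31949, 940823, 22008, 188199, 31916, 862862, 6383, 188239, 159737, 34508, 31946,
    550363, 6389, 798487, 6383, 178258, 190758, 7529, 110069, 798548, 159747, 178258, 880, 37633,
    34514, 172559, 159741, 34508, 115758, 37633, 38154, 31949, 862739, 940997, 6389, 23154,
    159697, 862823, 2894319, 22008, 190758, 159569, 31939, 31949, 159673, 22008, 1505, 34508,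
    4404, 172559, 188197, 31947, 31939, 34508, 6383],
   [31947, 1276, 472763, 797808, 159616, 31949, 6389, 31916, 1277, 475763, 798623, 159672, 31908,
    6383, 31916, 6383, 6388, 3988449, 6384, 3992336, 891283, 255, 798708, 891314, 31923, 159741,
    31914, 799566, 31934, 159548, 159539, 31918, 159541, 23865838, 159737, 799721, 797924, 18910,
    178258, 159574, 31949, 159921, 797962, 159668, 159541, 159599, 2363819, 159623, 19030, 31919,
    798737, 159659, 11893939, 159619, 178258, 31908, 798683, 159941, 159698, 159674, 6387,
    891283, 797739, 159667, 7130, 2378788, 159747, 159713, 159559, 159544, 22303299, 159737,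
    178258, 6383, 35654, 6389, 798466, 6389, 798408, 31916, 159589, 159673, 2378813, 31949,
    798467, 31947, 38185, 31908, 798599, 798066, 4456797, 159541, 798619, 4773172, 31947, 31949,
    472763, 23185, 6383, 159747, 475763, 2378813, 891289, 31918, 891359, 178258, 6396, 797788,
    798083, 799571, 159541, 31916, 31996, 799596, 31908, 159673, 159941, 799691, 797688, 159566,
    6389, 6383, 178258, 31936, 159737, 178259, 159737, 159747, 159738, 6386, 31947, 31908, 31944,
    159612, 159572, 3991836, 31913, 891283, 31949, 35685, 6389, 799716, 159693, 159708, 798566,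
    31946, 3991836, 178258, 31916, 31917, 31949, 31921, 31933, 31908, 6383, 798571, 799691,
    159541, 798096, 31947, 159596, 35652, 797797, 798567, 31916, 159941, 31922, 798737],
   [31916, 193883, 31922, 84711, 84816, 31921, 160139, 3388, 3383, 84691, 16942, 84558, 159611,
    84693, 3388, 3389, 84716, 16942, 84723, 159611, 159543, 255, 159941, 159748, 84716, 84683,
    84541, 193888, 159941, 3384, 1276, 159723, 159622, 2147171, 6389, 159658, 1277, 3388, 84549,
    84796, 3384, 31916, 84691, 159558, 159543, 6388, 31916, 84821, 6383, 84743, 159546, 84611,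
    31947, 3435, 6383, 84573, 84746, 4003416, 3384, 84586, 6389, 677, 84598, 160138, 6383, 31947,
    6389, 159564, 84559, 16941, 6396, 16921, 800709, 31938, 159716, 160139, 84693, 16921, 31946,
    3384, 97133, 84659, 3388, 159559, 969422, 3384, 16918, 160134, 85889, 84736, 159696, 31943,
    97139, 193884, 159921, 159696, 429446, 6389, 159692, 84623, 85883, 159592, 135, 159538,
    84586, 193883, 3388, 84791, 429483, 159724, 6386, 31947, 159543, 159598, 159592, 6383, 84821,
    31916, 6384, 676, 16942, 159736, 6383, 84563, 6389, 84549, 16942, 3384, 16916, 31941, 6405,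
    84539, 485667, 159586, 16946, 16921, 16947, 159916, 85888, 97134, 6389, 31942, 16917, 3885,
    159684, 800691, 31916, 159673, 7755, 159946, 159618, 3388, 16921, 84697, 6383, 84599, 85888,
    969488, 16921, 159711, 3391, 159543, 485714, 97134, 31947, 84592, 3386, 16908],
   [31911, 110139, 31918, 863158, 31948, 797791, 159673, 31981, 159737, 863193, 159563, 550658,
    31908, 159591, 6905, 159737, 159711, 159606, 159669, 798596, 159673, 255, 550663, 110133,
    31922, 797798, 159696, 159558, 159921, 819514, 31944, 797691, 1276, 4847534, 159698, 798091,
    799606, 6389, 159569, 798421, 172633, 31947, 863184, 172633, 159541, 1277, 550673, 159567,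
    550694, 6384, 22180, 31942, 31916, 159612, 6389, 31908, 159542, 863158, 31918, 550664, 6389,
    550659, 6396, 159539, 159569, 31916, 159568, 797711, 31943, 159712, 6389, 159737, 159694,
    798366, 159571, 159591, 6383, 159737, 172633, 863163, 159736, 6381, 31942, 159538, 159673,
    31916, 6383, 31908, 31914, 159613, 159668, 159541, 31941, 798736, 38780, 799696, 31921,
    159591, 31941, 6383, 550668, 31918, 31947, 159743, 31922, 6383, 550694, 159613, 159946,
    159598, 159541, 31931, 6388, 31918, 31908, 797846, 798621, 4405, 819514, 6383, 6389, 159569,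
    159668, 31921, 159614, 159581, 6389, 863193, 6386, 159592, 550668, 31908, 863198, 172639,
    31909, 31947, 31946, 159738, 159544, 6388, 863184, 159746, 554508, 110133, 31918, 6383,
    31916, 159741, 4847568, 159581, 798296, 32780, 798556, 31908, 159581, 110133, 31918, 159541,
    31934, 6387, 159706, 159731, 159617, 797848, 31916, 159618, 159623, 159591],
   [31947, 6383, 1276, 3384, 31913, 84573, 159543, 31916, 6389, 1277, 3384, 31944, 84669, 159699,
    31916, 16921, 3388, 507135, 16941, 84733, 84687, 255, 84672, 31909, 84693, 84573, 16919,
    159597, 84693, 16921, 3388, 677, 6389, 16933, 159673, 159571, 16939, 159543, 159673, 31944,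
    84721, 135, 31924, 6387, 16906, 3388, 31916, 84606, 159699, 16914, 6383, 84606, 16948, 3391,
    16942, 84566, 84617, 31916, 6381, 16921, 159737, 6389, 16918, 84669, 159581, 31916, 6383,
    16911, 3386, 31913, 16937, 159586, 31911, 6389, 159581, 84712, 6383, 6383, 16949, 16921,
    3381, 84616, 31937, 84549, 6389, 16919, 159569, 84549, 16942, 3384, 676, 31986, 84712, 6396,
    16921, 16933, 3388, 159569, 84712, 159581, 3388, 31906, 84816, 16961, 3384, 159736, 84589,
    84712, 16908, 422933, 159737, 16914, 159737, 423664, 16948, 159581, 428930, 84711, 16942,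
    84531, 159946, 6389, 159737, 6383, 3384, 159581, 159581, 84606, 159709, 798538, 84796, 31938,
    31934, 159737, 31934, 31916, 31923, 3388, 159667, 6386, 6383, 801535, 31946, 159613, 159531,
    16921, 31947, 3384, 31947, 16921, 31943, 84606, 3387, 159741, 159916, 798059, 957630, 84606,
    84712, 31916, 31923, 6389, 159596, 159687, 84611, 3384, 84606, 3388]]

/-- First generator of the representative number `i`. -/
def psU (i : ℕ) : ℕ := (psGens.getD i (344, 344)).1

/-- Second generator of the representative number `i`. -/
def psV (i : ℕ) : ℕ := (psGens.getD i (344, 344)).2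

/-- Check that `d` conjugates `y` into the element `x`, that is, `d y = x d`. -/
def psConj (d y x : ℕ) : Bool := psEq (psMul d y) (psMul x d)

/-- Either `g` is a word in the generators `u, v` of representative `i`, or `u, v, g` generate
a group containing a conjugate of a representative with larger number. -/
def psUpCheck (i u v g t : ℕ) : Bool :=
  psForce (fun x => psEq x g) (psEval [u, v] (t / 65536)) ||
  (Nat.ble (i + 1) (t % 16) && Nat.ble (t % 16) 14 && psDet (t / 16 % 4096) &&
    psForce (psConj (t / 16 % 4096) (psU (t % 16))) (psEval [u, v, g] (t / 65536)) &&
    psForce (psConj (t / 16 % 4096) (psV (t % 16)))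
      (psEval [u, v, g] (psSkip 12 (t / 65536))))

/-- Check that `n` normalizes `⟨u, v⟩`, with words `a, b` for the conjugates of `u, v`. -/
def psNorm (u v a b n : ℕ) : Bool :=
  psForce (fun x => psEq (psMul u n) (psMul n x)) (psEval [u, v] a) &&
  psForce (fun x => psEq (psMul v n) (psMul n x)) (psEval [u, v] b)

/-- The word `x` in `u, v, u^g, v^g` satisfies: `n = x g⁻¹` normalizes `⟨u, v⟩`. -/
def psProCheck (u v g t : ℕ) : Bool :=
  psForce (fun u' => psForce (fun v' => psForce (fun x =>
    psForce (psNorm u v (psSkip 12 t) (psSkip 12 (psSkip 12 t))) (psMul x (psInv g)))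
    (psEval [u, v, u', v'] t)) (psMul (psInv g) (psMul v g))) (psMul (psInv g) (psMul u g))

theorem psGens_ok : ∀ i < 15, psDet (psU i) = true ∧ psDet (psV i) = true := by
  decide +kernel

theorem psGens_ne : ∀ i < 15, 2 ≤ i → psScal (psU i) = false ∧ psScal (psV i) = false ∧
    psScal (psMul (psInv (psU i)) (psV i)) = false := by
  decide +kernel

theorem psNorm_ok : ∀ x < 2401, psDet x = true →
    psOk x = true ∨ (psNeg x < 2401 ∧ psOk (psNeg x) = true) := by
  decide +kernel

theorem psUp_ok : ∀ i < 15,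
    psForce (fun u => psForce (fun v => psAll (psUpCheck i u v) psElems (psUp.getD i [])) (psV i)) (psU i) = true := by
  decide +kernel

theorem psPro_ok : ∀ i < 15, i ≠ 1 →
    psForce (fun u => psForce (fun v => psAll (psProCheck u v) psElems (psPro.getD i [])) (psV i)) (psU i) = true := by
  decide +kernel

theorem psTwo_ok : psEq (psMul (psU 1) (psU 1)) 344 = true ∧ psScal (psU 1) = false ∧
    psDet 120 = true ∧
    psEq (psMul (psU 1) (psMul (psInv 120) (psMul (psU 1) 120)))
      (psMul (psMul (psInv 120) (psMul (psU 1) 120)) (psU 1)) = true ∧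
    psScal (psMul (psInv (psU 1)) (psMul (psInv 120) (psMul (psU 1) 120))) = false ∧
    psV 1 = psU 1 ∧ psU 0 = 344 ∧ psV 0 = 344 := by
  decide +kernel

/-! ### Relating codes with group elements -/

section theory

variable {F : Type*} [Field F]

/-- The matrix with code `x`. -/
def psM (F : Type*) [Field F] (x : ℕ) : Matrix (Fin 2) (Fin 2) F :=
  !![((x / 343 : ℕ) : F), ((x / 49 % 7 : ℕ) : F); ((x / 7 % 7 : ℕ) : F), ((x % 7 : ℕ) : F)]

/-- The code `x` represents the element `g`. -/
def PsRep (x : ℕ) (g : ProjectiveSpecialLinearGroup (Fin 2) F) : Prop :=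
  ∃ S : Matrix.SpecialLinearGroup (Fin 2) F,
    QuotientGroup.mk' (Subgroup.center (Matrix.SpecialLinearGroup (Fin 2) F)) S = g ∧
      (S : Matrix (Fin 2) (Fin 2) F) = psM F x

theorem ps_cast_mod [CharP F 7] (n : ℕ) : ((n % 7 : ℕ) : F) = n :=
  (CharP.cast_eq_mod F 7 n).symm

theorem psM_enc [CharP F 7] (a b c d : ℕ) :
    psM F (psEnc a b c d) = !![(a : F), (b : F); (c : F), (d : F)] := by
  have h1 : psEnc a b c d / 343 = a % 7 := by unfold psEnc; omega
  have h2 : psEnc a b c d / 49 % 7 = b % 7 := by unfold psEnc; omega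
  have h3 : psEnc a b c d / 7 % 7 = c % 7 := by unfold psEnc; omega
  have h4 : psEnc a b c d % 7 = d % 7 := by unfold psEnc; omega
  unfold psM
  rw [h1, h2, h3, h4]
  simp only [ps_cast_mod]

theorem ps_six [CharP F 7] : (6 : F) = -1 := by
  have h : ((7 : ℕ) : F) = 0 := CharP.cast_eq_zero F 7
  push_cast at h
  linear_combination h

theorem psM_mul [CharP F 7] (x y : ℕ) : psM F (psMul x y) = psM F x * psM F y := by
  rw [psMul, psM_enc, psM, psM, Matrix.mul_fin_two]
  push_cast
  rfl

theorem psM_neg [CharP F 7] (x : ℕ) : psM F (psNeg x) = - psM F x := by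
  rw [psNeg, psM_enc, psM]
  push_cast
  rw [ps_six]
  ext i j
  fin_cases i <;> fin_cases j <;> simp

theorem psM_inv [CharP F 7] (x : ℕ) : psM F (psInv x) = (psM F x).adjugate := by
  rw [psInv, psM_enc, psM, Matrix.adjugate_fin_two_of]
  push_cast
  rw [ps_six]
  ext i j
  fin_cases i <;> fin_cases j <;> simp

theorem PsRep.one [CharP F 7] : PsRep (F := F) 344 1 :=
  ⟨1, map_one _, by
    ext i j
    fin_cases i <;> fin_cases j <;> simp [psM]⟩

theorem PsRep.mul [CharP F 7] {x y : ℕ} {g h : ProjectiveSpecialLinearGroup (Fin 2) F}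
    (hx : PsRep x g) (hy : PsRep y h) : PsRep (psMul x y) (g * h) := by
  obtain ⟨S, rfl, hS⟩ := hx
  obtain ⟨T, rfl, hT⟩ := hy
  exact ⟨S * T, map_mul _ _ _, by
    rw [psM_mul, ← hS, ← hT]
    exact Matrix.SpecialLinearGroup.coe_mul S T⟩

theorem PsRep.inv [CharP F 7] {x : ℕ} {g : ProjectiveSpecialLinearGroup (Fin 2) F}
    (hx : PsRep x g) : PsRep (psInv x) g⁻¹ := by
  obtain ⟨S, rfl, hS⟩ := hx
  exact ⟨S⁻¹, map_inv _ _, by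
    rw [psM_inv, ← hS]
    exact Matrix.SpecialLinearGroup.coe_inv S⟩

theorem ps_neg_one_mem : (-1 : Matrix.SpecialLinearGroup (Fin 2) F) ∈
    Subgroup.center (Matrix.SpecialLinearGroup (Fin 2) F) := by
  rw [Subgroup.mem_center_iff]
  intro g
  ext i j
  simp

theorem PsRep.neg [CharP F 7] {x : ℕ} {g : ProjectiveSpecialLinearGroup (Fin 2) F}
    (hx : PsRep x g) : PsRep (psNeg x) g := by
  obtain ⟨S, rfl, hS⟩ := hx
  refine ⟨-1 * S, ?_, ?_⟩
  · rw [map_mul]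
    have h : QuotientGroup.mk' (Subgroup.center (Matrix.SpecialLinearGroup (Fin 2) F)) (-1) = 1 :=
      (QuotientGroup.eq_one_iff _).2 ps_neg_one_mem
    rw [h, one_mul]
  · rw [psM_neg, ← hS]
    simp

theorem PsRep.unique {x : ℕ} {g h : ProjectiveSpecialLinearGroup (Fin 2) F}
    (hx : PsRep x g) (hy : PsRep x h) : g = h := by
  obtain ⟨S, rfl, hS⟩ := hx
  obtain ⟨T, rfl, hT⟩ := hy
  congr 1
  exact Subtype.ext (hS.trans hT.symm)

theorem PsRep.eq_of [CharP F 7] {x y : ℕ} {g h : ProjectiveSpecialLinearGroup (Fin 2) F}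
    (hx : PsRep x g) (hy : PsRep y h) (e : psEq x y = true) : g = h := by
  rw [psEq, Bool.or_eq_true, Nat.beq_eq, Nat.beq_eq] at e
  rcases e with rfl | rfl
  · exact hx.unique hy
  · exact hx.unique hy.neg

theorem ps_cast_inj [CharP F 7] {a b : ℕ} (h : (a : F) = b) : a % 7 = b % 7 :=
  (CharP.natCast_eq_natCast F 7).1 h

theorem PsRep.scal [CharP F 7] {x : ℕ}
    (hx : PsRep x (1 : ProjectiveSpecialLinearGroup (Fin 2) F)) : psScal x = true := by
  obtain ⟨S, h1, hS⟩ := hx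
  have h2 : S ∈ Subgroup.center (Matrix.SpecialLinearGroup (Fin 2) F) :=
    (QuotientGroup.eq_one_iff _).1 h1
  obtain ⟨r, -, hr⟩ := Matrix.SpecialLinearGroup.mem_center_iff.1 h2
  rw [hS] at hr
  have h00 := congrFun (congrFun hr 0) 0
  have h01 := congrFun (congrFun hr 0) 1
  have h10 := congrFun (congrFun hr 1) 0
  have h11 := congrFun (congrFun hr 1) 1
  simp [psM] at h00 h01 h10 h11
  have e1 : ((x / 49 % 7 : ℕ) : F) = ((0 : ℕ) : F) := by rw [← h01]; simp
  have e2 : ((x / 7 % 7 : ℕ) : F) = ((0 : ℕ) : F) := by rw [← h10]; simp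
  have e3 : ((x / 343 : ℕ) : F) = ((x % 7 : ℕ) : F) := by rw [← h11, ← h00]
  have f1 := ps_cast_inj e1
  have f2 := ps_cast_inj e2
  have f3 := ps_cast_inj e3
  simp only [psScal, Bool.and_eq_true, Nat.beq_eq]
  omega

theorem ps_det_iff [CharP F 7] (x : ℕ) : psDet x = true ↔ (psM F x).det = 1 := by
  rw [psM, Matrix.det_fin_two_of, psDet, Nat.beq_eq]
  have h : ((x / 343 * (x % 7) + 6 * (x / 49 % 7 * (x / 7 % 7)) : ℕ) : F) =
      ((x / 343 : ℕ) : F) * ((x % 7 : ℕ) : F) - ((x / 49 % 7 : ℕ) : F) * ((x / 7 % 7 : ℕ) : F) := by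
    push_cast
    rw [ps_six]
    ring
  rw [← h]
  constructor
  · intro e
    rw [← ps_cast_mod, e]
    simp
  · intro e
    have := ps_cast_inj (F := F) (b := 1) (by rw [e]; simp)
    simpa using this

theorem ps_exists_of_det [CharP F 7] {x : ℕ} (h : psDet x = true) :
    ∃ g : ProjectiveSpecialLinearGroup (Fin 2) F, PsRep x g :=
  ⟨_, ⟨psM F x, (ps_det_iff x).1 h⟩, rfl, rfl⟩

theorem ps_exists_code [CharP F 7] (hs : ∀ a : F, ∃ n < 7, ((n : ℕ) : F) = a)
    (g : ProjectiveSpecialLinearGroup (Fin 2) F) : ∃ x ∈ psElems, PsRep x g := by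
  obtain ⟨S, rfl⟩ := QuotientGroup.mk'_surjective _ g
  obtain ⟨a, ha, ea⟩ := hs (S 0 0)
  obtain ⟨b, hb, eb⟩ := hs (S 0 1)
  obtain ⟨c, hc, ec⟩ := hs (S 1 0)
  obtain ⟨d, hd, ed⟩ := hs (S 1 1)
  have hM : (S : Matrix (Fin 2) (Fin 2) F) = psM F (psEnc a b c d) := by
    rw [psM_enc, ea, eb, ec, ed]
    exact Matrix.eta_fin_two _
  have hr : PsRep (psEnc a b c d)
      (QuotientGroup.mk' (Subgroup.center (Matrix.SpecialLinearGroup (Fin 2) F)) S) := ⟨S, rfl, hM⟩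
  have hlt : psEnc a b c d < 2401 := by unfold psEnc; omega
  have hdet : psDet (psEnc a b c d) = true := (ps_det_iff (F := F) _).2 (by rw [← hM]; exact S.2)
  rcases psNorm_ok _ hlt hdet with h | ⟨h1, h2⟩
  · exact ⟨_, List.mem_filter.2 ⟨List.mem_range.2 hlt, h⟩, hr⟩
  · exact ⟨_, List.mem_filter.2 ⟨List.mem_range.2 h1, h2⟩, hr.neg⟩

/-- The code `x` represents an element of `H`. -/
def PsIn (H : Subgroup (ProjectiveSpecialLinearGroup (Fin 2) F)) (x : ℕ) : Prop :=
  ∃ g ∈ H, PsRep x g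

theorem psIn_letter [CharP F 7] {H : Subgroup (ProjectiveSpecialLinearGroup (Fin 2) F)} :
    ∀ (l : List ℕ) (_ : ∀ a ∈ l, PsIn H a) (k : ℕ), PsIn H (psLetter l k)
  | [], _, _ => ⟨1, H.one_mem, PsRep.one⟩
  | a :: l, hl, k => by
    rw [psLetter]
    cases Nat.beq k 1
    · exact psIn_letter l (fun b hb => hl b (List.mem_cons_of_mem _ hb)) _
    · exact hl a List.mem_cons_self

theorem psIn_word [CharP F 7] {H : Subgroup (ProjectiveSpecialLinearGroup (Fin 2) F)}
    (l : List ℕ) (hl : ∀ a ∈ l, PsIn H a) :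
    ∀ (n w acc : ℕ) (_ : PsIn H acc), PsIn H (psWord l n w acc)
  | 0, _, _, h => h
  | n + 1, w, acc, h => by
    rw [psWord]
    cases Nat.beq (w % 5) 0
    · rw [cond_false, psForce_eq, psForce_eq]
      refine psIn_word l hl n _ _ ?_
      obtain ⟨g, hg, rg⟩ := h
      obtain ⟨k, hk, rk⟩ := psIn_letter l hl (w % 5)
      exact ⟨g * k, H.mul_mem hg hk, rg.mul rk⟩
    · exact h

theorem psIn_eval [CharP F 7] {H : Subgroup (ProjectiveSpecialLinearGroup (Fin 2) F)}
    (l : List ℕ) (hl : ∀ a ∈ l, PsIn H a) (w : ℕ) : PsIn H (psEval l w) :=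
  psIn_word l hl _ _ _ ⟨1, H.one_mem, PsRep.one⟩

end theory

/-! ### Conjugation -/

section conj

variable {G : Type*} [Group G]

theorem ps_mem_conjugate {H : Subgroup G} {g x : G} :
    x ∈ H.conjugate g ↔ g * x * g⁻¹ ∈ H := by
  unfold Subgroup.conjugate
  rw [Subgroup.mem_map]
  constructor
  · rintro ⟨y, hy, rfl⟩
    simpa [mul_assoc] using hy
  · intro h
    exact ⟨_, h, by simp [mul_assoc]⟩

theorem ps_conjugate_conjugate (H : Subgroup G) (a b : G) :
    (H.conjugate a).conjugate b = H.conjugate (a * b) := by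
  ext x
  simp [ps_mem_conjugate, mul_assoc]

theorem ps_conjugate_one (H : Subgroup G) : H.conjugate 1 = H := by
  ext x
  simp [ps_mem_conjugate]

theorem ps_conjugate_sup (H K : Subgroup G) (a : G) :
    (H ⊔ K).conjugate a = H.conjugate a ⊔ K.conjugate a :=
  Subgroup.map_sup _ _ _

theorem ps_card_conjugate (H : Subgroup G) (a : G) : Nat.card (H.conjugate a) = Nat.card H :=
  (Nat.card_congr (H.equivMapOfInjective _ (MulAut.conj a⁻¹).injective).toEquiv).symm

theorem ps_pronormal_conjugate {H : Subgroup G} (h : IsPronormal H) (c : G) :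
    IsPronormal (H.conjugate c) := by
  intro g
  obtain ⟨x, hx, e⟩ := h (c * g * c⁻¹)
  refine ⟨c⁻¹ * x * c, ?_, ?_⟩
  · have h1 : c⁻¹ * x * c ∈ (H ⊔ H.conjugate (c * g * c⁻¹)).conjugate c := by
      rw [ps_mem_conjugate]
      simpa [mul_assoc] using hx
    rw [ps_conjugate_sup, ps_conjugate_conjugate] at h1
    rw [ps_conjugate_conjugate]
    simpa [mul_assoc] using h1
  · have h1 := congrArg (fun K => Subgroup.conjugate K c) e
    simp only [ps_conjugate_conjugate] at h1 ⊢
    simpa [mul_assoc] using h1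

theorem ps_pronormal_conjugate_iff (H : Subgroup G) (c : G) :
    IsPronormal (H.conjugate c) ↔ IsPronormal H := by
  refine ⟨fun h => ?_, fun h => ps_pronormal_conjugate h c⟩
  have := ps_pronormal_conjugate h c⁻¹
  rwa [ps_conjugate_conjugate, mul_inv_cancel, ps_conjugate_one] at this

/-- The criterion for pronormality of a two generated finite subgroup. -/
theorem ps_conjugate_eq [Finite G] {H : Subgroup G} {u v n : G} (hH : H ≤ Subgroup.closure {u, v})
    (hu : n⁻¹ * u * n ∈ H) (hv : n⁻¹ * v * n ∈ H) : H.conjugate n = H := by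
  have h1 : H ≤ H.conjugate n⁻¹ := by
    refine hH.trans ((Subgroup.closure_le _).2 ?_)
    rintro x (rfl | rfl)
    · exact ps_mem_conjugate.2 (by simpa using hu)
    · exact ps_mem_conjugate.2 (by simpa using hv)
  have h2 : H = H.conjugate n⁻¹ :=
    Subgroup.eq_of_le_of_card_ge h1 (ps_card_conjugate H _).le
  conv_lhs => rw [h2]
  rw [ps_conjugate_conjugate, inv_mul_cancel, ps_conjugate_one]

theorem ps_pronormal_of [Finite G] {H : Subgroup G} {u v : G}
    (hH : H ≤ Subgroup.closure {u, v})
    (h : ∀ g : G, ∃ x ∈ H ⊔ H.conjugate g, ∃ a ∈ H, ∃ b ∈ H,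
      u * (x * g⁻¹) = x * g⁻¹ * a ∧ v * (x * g⁻¹) = x * g⁻¹ * b) : IsPronormal H := by
  intro g
  obtain ⟨x, hx, a, ha, b, hb, e1, e2⟩ := h g
  refine ⟨x, hx, ?_⟩
  have h1 : H.conjugate (x * g⁻¹) = H := by
    refine ps_conjugate_eq hH ?_ ?_
    · rw [mul_assoc, e1, inv_mul_cancel_left]; exact ha
    · rw [mul_assoc, e2, inv_mul_cancel_left]; exact hb
  conv_rhs => rw [← h1]
  rw [ps_conjugate_conjugate, inv_mul_cancel_right]

theorem ps_card_ne_two {H : Subgroup G} {u v : G} (hu : u ∈ H) (hv : v ∈ H) (h1 : u ≠ 1)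
    (h2 : v ≠ 1) (h3 : u⁻¹ * v ≠ 1) : Nat.card H ≠ 2 := by
  intro h
  obtain ⟨x, y, -, hxy⟩ := Nat.card_eq_two_iff.1 h
  have key : ∀ z : H, z = x ∨ z = y := fun z => by
    have : z ∈ ({x, y} : Set H) := by rw [hxy]; trivial
    simpa using this
  have h3' : u ≠ v := fun e => h3 (by rw [e, inv_mul_cancel])
  have k0 := key 1
  have k1 := key ⟨u, hu⟩
  have k2 := key ⟨v, hv⟩
  have n1 : (⟨u, hu⟩ : H) ≠ 1 := fun e => h1 (congrArg Subtype.val e)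
  have n2 : (⟨v, hv⟩ : H) ≠ 1 := fun e => h2 (congrArg Subtype.val e)
  have n3 : (⟨u, hu⟩ : H) ≠ ⟨v, hv⟩ := fun e => h3' (congrArg Subtype.val e)
  grind

theorem ps_not_pronormal [Finite G] {u g : G} (hc : u * (g⁻¹ * (u * g)) = g⁻¹ * (u * g) * u)
    (h2 : u * u = 1) (h1 : u ≠ 1) (hne : u⁻¹ * (g⁻¹ * (u * g)) ≠ 1) {H : Subgroup G}
    (hu : u ∈ H) (hH : H ≤ Subgroup.closure {u, u}) : ¬ IsPronormal H ↔ Nat.card H = 2 := by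
  have e : H = Subgroup.zpowers u := by
    refine le_antisymm ?_ (Subgroup.zpowers_le.2 hu)
    rwa [Set.pair_eq_singleton, ← Subgroup.zpowers_eq_closure] at hH
  have ho : orderOf u = 2 := orderOf_eq_prime (by rw [pow_two, h2]) h1
  have hcard : Nat.card H = 2 := by rw [e, Nat.card_zpowers, ho]
  refine ⟨fun _ => hcard, fun _ hp => ?_⟩
  obtain ⟨x, hx, ex⟩ := hp g
  have hle : H ⊔ H.conjugate g ≤ Subgroup.centralizer {u} := by
    refine sup_le ?_ ?_
    · rw [e, Subgroup.zpowers_le, Subgroup.mem_centralizer_singleton_iff]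
    · rw [e, Subgroup.conjugate, MonoidHom.map_zpowers, Subgroup.zpowers_le,
        Subgroup.mem_centralizer_singleton_iff]
      simp [mul_assoc] at hc ⊢
      first | exact hc | exact hc.symm
  have hxu := Subgroup.mem_centralizer_singleton_iff.1 (hle hx)
  have hm : u ∈ H.conjugate x := by
    rw [ps_mem_conjugate]
    rw [hxu, mul_inv_cancel_right]
    exact hu
  have hxe : H.conjugate x = H := by
    symm
    refine Subgroup.eq_of_le_of_card_ge ?_ (ps_card_conjugate H x).le
    conv_lhs => rw [e]
    exact Subgroup.zpowers_le.2 hm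
  have hg : g⁻¹ * (u * g) ∈ H := by
    rw [← hxe, ex, ps_mem_conjugate]
    simpa [mul_assoc] using hu
  refine ps_card_ne_two hu hg h1 (fun h => h1 ?_) hne hcard
  have h3 : g = u * g := by simpa using inv_mul_eq_one.1 h
  simpa using h3.symm

end conj

section main

variable {F : Type*} [Field F] [Finite F] [CharP F 7]

/-- The theorem for subgroups generated by the generators of a representative. -/
theorem ps_direct (hs : ∀ a : F, ∃ n < 7, ((n : ℕ) : F) = a) (i : ℕ) (hi : i < 15)
    (H : Subgroup (ProjectiveSpecialLinearGroup (Fin 2) F))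
    (hU : PsIn H (psU i)) (hV : PsIn H (psV i))
    (hg : ∀ g ∈ H, ∃ w, PsRep (psEval [psU i, psV i] w) g) :
    ¬ IsPronormal H ↔ Nat.card H = 2 := by
  obtain ⟨u, hu, ru⟩ := hU
  obtain ⟨v, hv, rv⟩ := hV
  have hH : H ≤ Subgroup.closure {u, v} := by
    intro g hgH
    obtain ⟨w, hw⟩ := hg g hgH
    obtain ⟨k, hk, rk⟩ := psIn_eval (H := Subgroup.closure {u, v}) [psU i, psV i] (by
      intro a ha
      simp only [List.mem_cons, List.not_mem_nil, or_false] at ha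
      rcases ha with rfl | rfl
      · exact ⟨u, Subgroup.subset_closure (by simp), ru⟩
      · exact ⟨v, Subgroup.subset_closure (by simp), rv⟩) w
    rwa [hw.unique rk]
  obtain ⟨t1, t2, t3, t4, t5, t6, t7, t8⟩ := psTwo_ok
  by_cases h1 : i = 1
  · subst h1
    rw [t6] at rv
    obtain rfl := ru.unique rv
    obtain ⟨g, rg⟩ := ps_exists_of_det (F := F) t3
    have rc := rg.inv.mul (ru.mul rg)
    refine ps_not_pronormal (g := g) ((ru.mul rc).eq_of (rc.mul ru) t4)
      ((ru.mul ru).eq_of PsRep.one t1) ?_ ?_ hu hH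
    · rintro rfl
      rw [ru.scal] at t2
      exact Bool.noConfusion t2
    · intro e
      have r := ru.inv.mul rc
      rw [e] at r
      rw [r.scal] at t5
      exact Bool.noConfusion t5
  · have hp : IsPronormal H := by
      refine ps_pronormal_of hH fun g => ?_
      obtain ⟨c, hc, rg⟩ := ps_exists_code hs g
      have hpro := psPro_ok i hi h1
      rw [psForce_eq, psForce_eq] at hpro
      obtain ⟨t, ht⟩ := psAll_spec _ _ _ hpro c hc
      simp only [psProCheck, psNorm, psForce_eq, Bool.and_eq_true] at ht
      have hl : ∀ a ∈ [psU i, psV i], PsIn H a := by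
        intro a ha
        simp only [List.mem_cons, List.not_mem_nil, or_false] at ha
        rcases ha with rfl | rfl
        · exact ⟨u, hu, ru⟩
        · exact ⟨v, hv, rv⟩
      obtain ⟨x, hx, rx⟩ := psIn_eval (H := H ⊔ H.conjugate g) [psU i, psV i,
          psMul (psInv c) (psMul (psU i) c), psMul (psInv c) (psMul (psV i) c)] (by
        intro a ha
        simp only [List.mem_cons, List.not_mem_nil, or_false] at ha
        rcases ha with rfl | rfl | rfl | rfl
        · exact ⟨u, Subgroup.mem_sup_left hu, ru⟩
        · exact ⟨v, Subgroup.mem_sup_left hv, rv⟩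
        · exact ⟨_, Subgroup.mem_sup_right (ps_mem_conjugate.2 (by simpa [mul_assoc] using hu)),
            rg.inv.mul (ru.mul rg)⟩
        · exact ⟨_, Subgroup.mem_sup_right (ps_mem_conjugate.2 (by simpa [mul_assoc] using hv)),
            rg.inv.mul (rv.mul rg)⟩) t
      obtain ⟨a, ha, ra⟩ := psIn_eval [psU i, psV i] hl (psSkip 12 t)
      obtain ⟨b, hb, rb⟩ := psIn_eval [psU i, psV i] hl (psSkip 12 (psSkip 12 t))
      have rn := rx.mul rg.inv
      exact ⟨x, hx, a, ha, b, hb, (ru.mul rn).eq_of (rn.mul ra) ht.1,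
        (rv.mul rn).eq_of (rn.mul rb) ht.2⟩
    have hc : Nat.card H ≠ 2 := by
      rcases Nat.lt_or_ge i 2 with h2 | h2
      · obtain rfl : i = 0 := by omega
        rw [t7] at ru
        rw [t8] at rv
        obtain rfl := ru.unique PsRep.one
        obtain rfl := rv.unique PsRep.one
        have : H = ⊥ := by
          rw [eq_bot_iff]
          exact hH.trans (by simp)
        rw [this]
        simp
      · obtain ⟨n1, n2, n3⟩ := psGens_ne i hi h2
        refine ps_card_ne_two hu hv ?_ ?_ ?_
        · rintro rfl
          rw [ru.scal] at n1
          exact Bool.noConfusion n1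
        · rintro rfl
          rw [rv.scal] at n2
          exact Bool.noConfusion n2
        · intro e
          have r := ru.inv.mul rv
          rw [e] at r
          rw [r.scal] at n3
          exact Bool.noConfusion n3
    exact ⟨fun h => absurd hp h, fun h => absurd h hc⟩

/-- Descending induction on the number of the representative contained in `H`. -/
theorem ps_induct (hs : ∀ a : F, ∃ n < 7, ((n : ℕ) : F) = a) (m : ℕ) :
    ∀ (i : ℕ) (_ : i < 15) (_ : 15 ≤ i + m)
      (H : Subgroup (ProjectiveSpecialLinearGroup (Fin 2) F))
      (_ : PsIn H (psU i)) (_ : PsIn H (psV i)),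
    (¬ IsPronormal H ↔ Nat.card H = 2) := by
  induction m with
  | zero => intro i h1 h2; omega
  | succ m ih =>
    intro i hi him H hU hV
    by_cases hg : ∀ g ∈ H, ∃ w, PsRep (psEval [psU i, psV i] w) g
    · exact ps_direct hs i hi H hU hV hg
    · push Not at hg
      obtain ⟨g, hgH, hg⟩ := hg
      obtain ⟨c, hc, rg⟩ := ps_exists_code hs g
      have hup := psUp_ok i hi
      rw [psForce_eq, psForce_eq] at hup
      obtain ⟨t, ht⟩ := psAll_spec _ _ _ hup c hc
      simp only [psUpCheck, psConj, psForce_eq] at ht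
      rw [Bool.or_eq_true] at ht
      rcases ht with ht | ht
      · obtain ⟨k, -, rk⟩ := psIn_eval (H := H) [psU i, psV i] (by
          intro a ha
          simp only [List.mem_cons, List.not_mem_nil, or_false] at ha
          rcases ha with rfl | rfl
          · exact hU
          · exact hV) (t / 65536)
        refine absurd ?_ (hg (t / 65536))
        rw [← rk.eq_of rg ht]
        exact rk
      · simp only [Bool.and_eq_true, Nat.ble_eq] at ht
        obtain ⟨⟨⟨⟨h1, h2⟩, h3⟩, h4⟩, h5⟩ := ht
        have hl : ∀ a ∈ [psU i, psV i, c], PsIn H a := by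
          intro a ha
          simp only [List.mem_cons, List.not_mem_nil, or_false] at ha
          rcases ha with rfl | rfl | rfl
          · exact hU
          · exact hV
          · exact ⟨g, hgH, rg⟩
        generalize t % 16 = j at *
        generalize t / 16 % 4096 = d at *
        obtain ⟨y, ry⟩ := ps_exists_of_det (F := F) h3
        obtain ⟨hju, hjv⟩ := psGens_ok j (by omega)
        obtain ⟨u, ru⟩ := ps_exists_of_det (F := F) hju
        obtain ⟨v, rv⟩ := ps_exists_of_det (F := F) hjv
        obtain ⟨a, ha, ra⟩ := psIn_eval _ hl (t / 65536)
        obtain ⟨b, hb, rb⟩ := psIn_eval _ hl (psSkip 12 (t / 65536))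
        have e1 := (ry.mul ru).eq_of (ra.mul ry) h4
        have e2 := (ry.mul rv).eq_of (rb.mul ry) h5
        have := ih j (by omega) (by omega) (H.conjugate y)
          ⟨u, ps_mem_conjugate.2 (by rw [e1, mul_inv_cancel_right]; exact ha), ru⟩
          ⟨v, ps_mem_conjugate.2 (by rw [e2, mul_inv_cancel_right]; exact hb), rv⟩
        rwa [ps_pronormal_conjugate_iff, ps_card_conjugate] at this

end main

theorem stmt3 (F : Type*) [Field F] [Fintype F] (hF : Fintype.card F = 7)
    (H : Subgroup (Matrix.ProjectiveSpecialLinearGroup (Fin 2) F)) :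
    ¬ IsPronormal H ↔ Nat.card H = 2 := by
  have : Fact (Nat.Prime 7) := ⟨by norm_num⟩
  have : CharP F 7 := charP_of_card_eq_prime hF
  have hs : ∀ a : F, ∃ n < 7, ((n : ℕ) : F) = a := by
    intro a
    have hb : Function.Bijective (ZMod.castHom (dvd_refl 7) F) :=
      ZMod.castHom_bijective F hF
    obtain ⟨z, rfl⟩ := hb.2 a
    exact ⟨z.val, ZMod.val_lt z, by rw [← map_natCast (ZMod.castHom (dvd_refl 7) F),
      ZMod.natCast_zmod_val]⟩
  obtain ⟨-, -, -, -, -, -, t7, t8⟩ := psTwo_ok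
  refine ps_induct hs 15 0 (by norm_num) (by norm_num) H ?_ ?_
  · rw [t7]; exact ⟨1, H.one_mem, PsRep.one⟩
  · rw [t8]; exact ⟨1, H.one_mem, PsRep.one⟩
end
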